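/- arXiv:2602.06199 — 2 statements merged into one kernel-verified Lean document; each statement's English description precedes it below -/
import Mathlib

section
/- Assume the Riemann hypothesis. Then for every real t > 0 there exists a real number E with |E| ≤ 7/(4t²) such that Re(ζ'/ζ(1 + i t)) = Σ_γ (1/2)/(1/4 + (t − γ)²) − (1/2) log(t/(2π)) + E, where the sum runs over the ordinates γ of the non-trivial zeros ρ = 1/2 + iγ of ζ(s), counted with multiplicity. -/
open Complex


/-- The set of non-trivial zeros of the Riemann zeta-function,
i.e. the zeros `ρ` with `0 < Re ρ < 1`. -/
def zetaNontrivialZeros : Set ℂ :=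
  {ρ : ℂ | riemannZeta ρ = 0 ∧ 0 < ρ.re ∧ ρ.re < 1}

/-- The multiplicity of `ρ` as a zero of the Riemann zeta-function: the smallest `n`
such that the `n`-th derivative of `ζ` does not vanish at `ρ`. -/
noncomputable def zetaZeroMult (ρ : ℂ) : ℕ :=
  sInf {n : ℕ | iteratedDeriv n riemannZeta ρ ≠ 0}


open Filter Topology MeasureTheory Metric Set in
lemma zz_tendsto_deriv {F : ℕ → ℂ → ℂ} {f : ℂ → ℂ} {c : ℂ} {R C : ℝ} (hR : 0 < R)
    (hF : ∀ᶠ n in atTop, DifferentiableOn ℂ (F n) (closedBall c R))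
    (hf : DifferentiableOn ℂ f (closedBall c R))
    (hb : ∀ᶠ n in atTop, ∀ z ∈ sphere c R, ‖F n z‖ ≤ C)
    (hl : ∀ z ∈ sphere c R, Tendsto (fun n => F n z) atTop (𝓝 (f z))) :
    Tendsto (fun n => deriv (F n) c) atTop (𝓝 (deriv f c)) := by
  have key : ∀ g : ℂ → ℂ, DifferentiableOn ℂ g (closedBall c R) →
      deriv g c = (2 * Real.pi * I)⁻¹ * ∮ z in C(c, R), (1 / (z - c) ^ 2) • g z := by
    intro g hg
    rw [hg.deriv_eq_smul_circleIntegral hR]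
    have : (2 * Real.pi * I : ℂ) ≠ 0 := by simp [Real.pi_ne_zero]
    rw [smul_eq_mul, inv_mul_cancel_left₀ this]
  rw [key f hf]
  have h1 : Tendsto (fun n => (2 * Real.pi * I)⁻¹ * ∮ z in C(c, R), (1 / (z - c) ^ 2) • F n z) atTop
      (𝓝 ((2 * Real.pi * I)⁻¹ * ∮ z in C(c, R), (1 / (z - c) ^ 2) • f z)) := by
    refine Tendsto.const_mul _ ?_
    unfold circleIntegral
    refine intervalIntegral.tendsto_integral_filter_of_dominated_convergence
      (fun _ => R * ((1 / R ^ 2) * C)) ?_ ?_ intervalIntegrable_const ?_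
    · filter_upwards [hF] with n hn
      refine Continuous.aestronglyMeasurable ?_
      have h2 : Continuous (fun θ => F n (circleMap c R θ)) := by
        refine hn.continuousOn.comp_continuous (continuous_circleMap c R) ?_
        intro θ
        exact sphere_subset_closedBall (circleMap_mem_sphere c hR.le θ)
      have h3 : ∀ θ, (circleMap c R θ - c) ^ 2 ≠ 0 := by
        intro θ
        exact pow_ne_zero _ (sub_ne_zero.mpr (circleMap_ne_center hR.ne'))
      have h4 : Continuous (fun θ => (1:ℂ) / (circleMap c R θ - c) ^ 2) :=
        continuous_const.div (by fun_prop) h3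
      have h5 : Continuous (fun θ => deriv (circleMap c R) θ) := by
        simp only [deriv_circleMap]
        fun_prop
      exact h5.smul (h4.smul h2)
    · filter_upwards [hb] with n hn
      refine Eventually.of_forall fun θ _ => ?_
      have := hn _ (circleMap_mem_sphere c hR.le θ)
      simp only [deriv_circleMap, norm_smul, norm_mul, norm_circleMap_zero, norm_I, mul_one,
        norm_div, norm_one, norm_pow, abs_of_pos hR]
      have h3 : ‖circleMap c R θ - c‖ = R := by
        rw [← dist_eq_norm]; exact circleMap_mem_sphere c hR.le θ
      rw [h3]
      gcongr
    · refine Eventually.of_forall fun θ _ => ?_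
      refine Tendsto.const_smul ?_ _
      exact (hl _ (circleMap_mem_sphere c hR.le θ)).const_smul _
  refine h1.congr' ?_
  filter_upwards [hF] with n hn
  rw [key _ hn]

lemma zz_prod_lower (θ : ℝ) (h0 : 0 ≤ θ) (h1 : θ ≤ 1) (m : ℕ) :
    (m.factorial : ℝ) * ((m : ℝ) + 1) ^ θ ≤ ∏ j ∈ Finset.range m, (1 + θ + (j : ℝ)) := by
  induction m with
  | zero => simp
  | succ m ih =>
    rw [Finset.prod_range_succ]
    have hm : (0 : ℝ) < (m : ℝ) + 1 := by positivity
    have hB := rpow_one_add_le_one_add_mul_self (s := 1 / ((m : ℝ) + 1)) (p := θ)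
      (by have : 0 ≤ 1 / ((m : ℝ) + 1) := by positivity
          linarith) h0 h1
    have h2 : ((m : ℝ) + 1 + 1) ^ θ = ((m : ℝ) + 1) ^ θ * (1 + 1 / ((m : ℝ) + 1)) ^ θ := by
      rw [← Real.mul_rpow (by positivity) (by positivity)]
      congr 1; field_simp
    push_cast [Nat.factorial_succ]
    rw [h2]
    have h3 : ((m : ℝ) + 1) * (1 + 1 / ((m : ℝ) + 1)) ^ θ ≤ 1 + θ + m := by
      calc ((m : ℝ) + 1) * (1 + 1 / ((m : ℝ) + 1)) ^ θ
          ≤ ((m : ℝ) + 1) * (1 + θ * (1 / ((m : ℝ) + 1))) := by gcongr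
        _ = 1 + θ + m := by field_simp; ring
    calc ((m : ℝ) + 1) * m.factorial * (((m : ℝ) + 1) ^ θ * (1 + 1 / ((m : ℝ) + 1)) ^ θ)
        = (m.factorial * ((m : ℝ) + 1) ^ θ) * (((m : ℝ) + 1) * (1 + 1 / ((m : ℝ) + 1)) ^ θ) := by
          ring
      _ ≤ (∏ j ∈ Finset.range m, (1 + θ + (j : ℝ))) * (1 + θ + m) := by
          gcongr

lemma zz_GammaSeq_bound (s : ℂ) (h1 : 1 ≤ s.re) (h2 : s.re ≤ 2) (n : ℕ) (hn : 0 < n) :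
    ‖GammaSeq s n‖ ≤ 1 := by
  unfold GammaSeq
  have hn' : (0 : ℝ) < n := by exact_mod_cast hn
  rw [norm_div, norm_mul, norm_prod, Complex.norm_natCast_cpow_of_pos hn, Complex.norm_natCast]
  have hp := zz_prod_lower (s.re - 1) (by linarith) (by linarith) (n + 1)
  have hle : ∏ j ∈ Finset.range (n + 1), (1 + (s.re - 1) + (j : ℝ)) ≤
      ∏ j ∈ Finset.range (n + 1), ‖s + j‖ := by
    refine Finset.prod_le_prod (fun j _ => by have : (0:ℝ) ≤ j := by positivity
                                              linarith) (fun j _ => ?_)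
    calc 1 + (s.re - 1) + (j : ℝ) = (s + j).re := by simp
      _ ≤ ‖s + j‖ := Complex.re_le_norm _
  have hpos : (0:ℝ) < ((n + 1).factorial : ℝ) * (((n + 1 : ℕ) : ℝ) + 1) ^ (s.re - 1) := by positivity
  rw [div_le_one (hpos.trans_le (hp.trans hle))]
  refine le_trans ?_ (hp.trans hle)
  have : (n : ℝ) ^ s.re = n * (n : ℝ) ^ (s.re - 1) := by
    nth_rewrite 2 [← Real.rpow_one (n : ℝ)]
    rw [← Real.rpow_add hn']; congr 1; ring
  rw [this]
  push_cast [Nat.factorial_succ]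
  have h4 : (n : ℝ) ^ (s.re - 1) ≤ ((n : ℝ) + 1 + 1) ^ (s.re - 1) := by
    apply Real.rpow_le_rpow <;> linarith
  calc (n : ℝ) * (n : ℝ) ^ (s.re - 1) * n.factorial
      ≤ (n + 1) * ((n : ℝ) + 1 + 1) ^ (s.re - 1) * n.factorial := by gcongr; linarith
    _ = _ := by ring

lemma zz_GammaSeq_diff (n : ℕ) (hn : 0 < n) (s : ℂ) (hs : 0 < s.re) :
    HasDerivAt (fun s => GammaSeq s n)
      (GammaSeq s n * (Complex.log n - ∑ j ∈ Finset.range (n + 1), 1 / (s + j))) s := by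
  have hne : ∀ j ∈ Finset.range (n + 1), s + (j : ℂ) ≠ 0 := by
    intro j _ h
    have := congrArg Complex.re h
    simp at this
    have h2 : (0:ℝ) ≤ j := by positivity
    linarith
  have hn' : (n : ℂ) ≠ 0 := by exact_mod_cast hn.ne'
  have hP : ∏ j ∈ Finset.range (n + 1), (s + (j:ℂ)) ≠ 0 := Finset.prod_ne_zero_iff.mpr hne
  have hd : DifferentiableAt ℂ (fun s => GammaSeq s n) s := by
    unfold GammaSeq
    refine DifferentiableAt.div ?_ ?_ hP
    · refine DifferentiableAt.mul ?_ (by fun_prop)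
      exact (differentiableAt_id).const_cpow (Or.inl hn')
    · fun_prop
  have hl : logDeriv (fun s => GammaSeq s n) s =
      Complex.log n - ∑ j ∈ Finset.range (n + 1), 1 / (s + j) := by
    unfold GammaSeq
    have hd1 : DifferentiableAt ℂ (fun s : ℂ => (n : ℂ) ^ s) s :=
      (differentiableAt_id).const_cpow (Or.inl hn')
    have hnz : (n : ℂ) ^ s ≠ 0 := by simp [Complex.cpow_eq_zero_iff, hn']
    have hfac : (n.factorial : ℂ) ≠ 0 := by exact_mod_cast n.factorial_ne_zero
    rw [logDeriv_div (f := fun s : ℂ => (n : ℂ) ^ s * (n.factorial : ℂ)) (g := fun s : ℂ => ∏ j ∈ Finset.range (n + 1), (s + (j:ℂ))) s (mul_ne_zero hnz hfac) hP (hd1.mul (by fun_prop)) (by fun_prop),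
      logDeriv_mul_const _ _ hfac, logDeriv_prod hne (fun i _ => by fun_prop)]
    congr 1
    · rw [logDeriv_apply]
      have : HasDerivAt (fun s : ℂ => (n : ℂ) ^ s) ((n : ℂ) ^ s * Complex.log n * 1) s :=
        (hasDerivAt_id s).const_cpow (Or.inl hn')
      rw [this.deriv]
      field_simp
    · refine Finset.sum_congr rfl fun j _ => ?_
      rw [logDeriv_apply]
      simp
  have hG : GammaSeq s n ≠ 0 := by
    unfold GammaSeq
    have hnz : (n : ℂ) ^ s ≠ 0 := by simp [Complex.cpow_eq_zero_iff, hn']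
    have hfac : (n.factorial : ℂ) ≠ 0 := by exact_mod_cast n.factorial_ne_zero
    exact div_ne_zero (mul_ne_zero hnz hfac) hP
  rw [← hl, logDeriv_apply, mul_div_cancel₀ _ hG]
  exact hd.hasDerivAt

open Filter Topology Metric in
lemma zz_digamma_tendsto (y : ℝ) :
    Tendsto (fun n : ℕ => Complex.log n - ∑ j ∈ Finset.range (n + 1), 1 / ((3 / 2 + y * I : ℂ) + j))
      atTop (𝓝 (logDeriv Gamma (3 / 2 + y * I))) := by
  set c : ℂ := 3 / 2 + y * I with hc
  have hcre : c.re = 3 / 2 := by simp [hc]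
  have hre : ∀ z ∈ closedBall c (1/2), 1 ≤ z.re ∧ z.re ≤ 2 := by
    intro z hz
    rw [mem_closedBall, dist_eq_norm] at hz
    have h := (Complex.abs_re_le_norm (z - c)).trans hz
    rw [abs_le] at h
    simp [hcre] at h
    constructor <;> linarith
  have hG : Gamma c ≠ 0 := Complex.Gamma_ne_zero_of_re_pos (by rw [hcre]; norm_num)
  have h1 : Tendsto (fun n => deriv (fun s => GammaSeq s n) c) atTop (𝓝 (deriv Gamma c)) := by
    refine zz_tendsto_deriv (R := 1/2) (C := 1) (by norm_num) ?_ ?_ ?_ ?_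
    · filter_upwards [eventually_gt_atTop 0] with n hn z hz
      exact (zz_GammaSeq_diff n hn z (by linarith [hre z hz])).differentiableAt.differentiableWithinAt
    · intro z hz
      refine (Complex.differentiableAt_Gamma _ ?_).differentiableWithinAt
      intro m h
      have h1 := (hre z hz).1
      rw [h] at h1
      simp at h1
      have : (0:ℝ) ≤ m := by positivity
      linarith
    · filter_upwards [eventually_gt_atTop 0] with n hn z hz
      have := hre z (sphere_subset_closedBall hz)
      exact zz_GammaSeq_bound z this.1 this.2 n hn
    · intro z _
      exact Complex.GammaSeq_tendsto_Gamma z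
  have h2 := h1.div (Complex.GammaSeq_tendsto_Gamma c) hG
  rw [logDeriv_apply]
  refine h2.congr' ?_
  have h3 := (Complex.GammaSeq_tendsto_Gamma c).eventually_ne hG
  filter_upwards [eventually_gt_atTop 0, h3] with n hn hne
  rw [Pi.div_apply, (zz_GammaSeq_diff n hn c (by rw [hcre]; norm_num)).deriv, mul_div_cancel_left₀ _ hne]

lemma zz_phi_re (a y : ℝ) : (1 / ((a : ℂ) + y * I)).re = a / (a ^ 2 + y ^ 2) := by
  rw [one_div, Complex.inv_re, Complex.normSq_apply]
  simp [pow_two]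

lemma zz_norm_lower (a b y : ℝ) (hb : 0 ≤ b) (hab : b ≤ a) (hy : 0 < y) :
    (b + y) / √2 ≤ ‖(a : ℂ) + y * I‖ := by
  rw [Complex.norm_add_mul_I, div_le_iff₀ (by positivity), ← Real.sqrt_mul (by positivity)]
  apply Real.le_sqrt_of_sq_le
  nlinarith [sq_nonneg (b - y), mul_le_mul hab hab hb (hb.trans hab)]

lemma zz_second_diff (x u y : ℝ) (hx : 1 / 2 ≤ x) (hu0 : 0 ≤ u) (hu : u ≤ 1 / 2) (hy : 0 < y) :
    |(x + u) / ((x + u) ^ 2 + y ^ 2) + (x - u) / ((x - u) ^ 2 + y ^ 2)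
      - 2 * (x / (x ^ 2 + y ^ 2))| ≤ √2 / (x - 1 / 2 + y) ^ 3 := by
  have him : ∀ a : ℝ, (a : ℂ) + y * I ≠ 0 := by
    intro a h
    have := congrArg Complex.im h
    simp at this
    linarith
  have h1 := him (x + u)
  have h2 := him (x - u)
  have h3 := him x
  have hid : (1 / (((x + u : ℝ) : ℂ) + y * I)) + (1 / (((x - u : ℝ) : ℂ) + y * I))
      - 2 * (1 / ((x : ℂ) + y * I)) =
      (2 * (u : ℂ) ^ 2) / (((x : ℂ) + y * I) * (((x + u : ℝ) : ℂ) + y * I) *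
        (((x - u : ℝ) : ℂ) + y * I)) := by
    field_simp
    push_cast
    ring
  have hre : (x + u) / ((x + u) ^ 2 + y ^ 2) + (x - u) / ((x - u) ^ 2 + y ^ 2)
      - 2 * (x / (x ^ 2 + y ^ 2)) = ((1 / (((x + u : ℝ) : ℂ) + y * I)) +
      (1 / (((x - u : ℝ) : ℂ) + y * I)) - 2 * (1 / ((x : ℂ) + y * I))).re := by
    rw [← zz_phi_re, ← zz_phi_re, ← zz_phi_re]
    simp
  rw [hre, hid]
  refine (Complex.abs_re_le_norm _).trans ?_
  rw [norm_div, norm_mul, norm_mul, norm_mul, norm_pow, Complex.norm_real, Complex.norm_two,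
    Real.norm_of_nonneg hu0]
  have hb : 0 ≤ x - 1 / 2 := by linarith
  have l1 := zz_norm_lower (x + u) (x - 1 / 2) y hb (by linarith) hy
  have l2 := zz_norm_lower (x - u) (x - 1 / 2) y hb (by linarith) hy
  have l3 := zz_norm_lower x (x - 1 / 2) y hb (by linarith) hy
  have hs : (0:ℝ) < √2 := by positivity
  have hs2 : √2 ^ 2 = (2:ℝ) := Real.sq_sqrt (by norm_num)
  set D := (x - 1 / 2 + y) / √2 with hD
  have hDpos : 0 < D := by have : 0 < x - 1/2 + y := by linarith
                           positivity
  calc 2 * u ^ 2 / (‖(x : ℂ) + y * I‖ * ‖((x + u : ℝ) : ℂ) + y * I‖ * ‖((x - u : ℝ) : ℂ) + y * I‖)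
      ≤ 2 * (1 / 2) ^ 2 / (D * D * D) := by gcongr
    _ = √2 / (x - 1 / 2 + y) ^ 3 := by
      have : x - 1 / 2 + y = D * √2 := by rw [hD]; field_simp
      rw [this, mul_pow]
      have : √2 ^ 3 = 2 * √2 := by rw [pow_succ, hs2]
      rw [this]
      field_simp

lemma zz_midpoint (x y : ℝ) (hx : 1 / 2 ≤ x) (hy : 0 < y) :
    |1 / 2 * Real.log ((x + 1 / 2) ^ 2 + y ^ 2) - 1 / 2 * Real.log ((x - 1 / 2) ^ 2 + y ^ 2)
      - x / (x ^ 2 + y ^ 2)| ≤ √2 / (x - 1 / 2 + y) ^ 3 / 2 := by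
  set G : ℝ → ℝ := fun u => 1 / 2 * Real.log ((x + u) ^ 2 + y ^ 2)
    - 1 / 2 * Real.log ((x - u) ^ 2 + y ^ 2) - 2 * u * (x / (x ^ 2 + y ^ 2)) with hG
  have hd : ∀ u, HasDerivAt G ((x + u) / ((x + u) ^ 2 + y ^ 2) + (x - u) / ((x - u) ^ 2 + y ^ 2)
      - 2 * (x / (x ^ 2 + y ^ 2))) u := by
    intro u
    have p1 : (x + u) ^ 2 + y ^ 2 ≠ 0 := by positivity
    have p2 : (x - u) ^ 2 + y ^ 2 ≠ 0 := by positivity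
    have a1 : HasDerivAt (fun u => (x + u) ^ 2 + y ^ 2) (2 * (x + u)) u := by
      have := (((hasDerivAt_id u).const_add x).pow 2).add_const (y ^ 2)
      simpa using this
    have a2 : HasDerivAt (fun u => (x - u) ^ 2 + y ^ 2) (-(2 * (x - u))) u := by
      have := (((hasDerivAt_id u).const_sub x).pow 2).add_const (y ^ 2)
      simpa using this
    have a3 : HasDerivAt (fun u : ℝ => 2 * u * (x / (x ^ 2 + y ^ 2))) (2 * 1 * (x / (x ^ 2 + y ^ 2))) u :=
      ((hasDerivAt_id u).const_mul 2).mul_const _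
    have := (((a1.log p1).const_mul (1 / 2)).sub ((a2.log p2).const_mul (1 / 2))).sub a3
    refine this.congr_deriv ?_
    field_simp
    ring
  have hm := (convex_Icc (0:ℝ) (1/2)).norm_image_sub_le_of_norm_hasDerivWithin_le (f := G)
    (C := √2 / (x - 1 / 2 + y) ^ 3) (x := 0) (y := 1 / 2)
    (fun u hu => (hd u).hasDerivWithinAt)
    (fun u hu => zz_second_diff x u y hx hu.1 hu.2 hy) (by norm_num) (by norm_num)
  have e0 : G 0 = 0 := by simp [hG]
  have e1 : G (1/2) = 1 / 2 * Real.log ((x + 1 / 2) ^ 2 + y ^ 2)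
      - 1 / 2 * Real.log ((x - 1 / 2) ^ 2 + y ^ 2) - x / (x ^ 2 + y ^ 2) := by
    simp only [hG]; ring
  rw [e0, sub_zero, e1] at hm
  refine hm.trans (le_of_eq ?_)
  rw [sub_zero, Real.norm_of_nonneg (by norm_num)]
  ring

lemma zz_sum_bound (y : ℝ) (hy : 0 < y) (n : ℕ) :
    |(1 / 2 * Real.log (((n : ℝ) + 1) ^ 2 + y ^ 2) - 1 / 2 * Real.log (1 + y ^ 2)) -
      ∑ k ∈ Finset.range n, ((k : ℝ) + 3 / 2) / (((k : ℝ) + 3 / 2) ^ 2 + y ^ 2)| ≤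
      3 / 8 * (1 / y ^ 2 - 1 / (n + y) ^ 2) := by
  induction n with
  | zero => simp
  | succ n ih =>
    rw [Finset.sum_range_succ]
    have hm := zz_midpoint ((n : ℝ) + 3 / 2) y (by have : (0:ℝ) ≤ n := by positivity
                                                   linarith) hy
    have e1 : (n : ℝ) + 3 / 2 + 1 / 2 = (n + 1) + 1 := by ring
    have e2 : (n : ℝ) + 3 / 2 - 1 / 2 = n + 1 := by ring
    rw [e1, e2] at hm
    have hs : √2 ≤ 3 / 2 := by
      rw [Real.sqrt_le_left (by norm_num)]; norm_num
    set X : ℝ := n + y with hX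
    have hXp : 0 < X := by positivity
    have e3 : (n : ℝ) + 1 + y = X + 1 := by rw [hX]; ring
    rw [e3] at hm
    have hkey : √2 / (X + 1) ^ 3 / 2 ≤ 3 / 8 * (1 / X ^ 2 - 1 / (X + 1) ^ 2) := by
      calc √2 / (X + 1) ^ 3 / 2 ≤ (3 / 2) / (X + 1) ^ 3 / 2 := by gcongr
        _ ≤ _ := by
          rw [div_sub_div _ _ (by positivity) (by positivity), div_div, mul_div_assoc',
            div_le_div_iff₀ (by positivity) (by positivity), ← sub_nonneg]
          have : 3 / 8 * (1 * (X + 1) ^ 2 - X ^ 2 * 1) * ((X + 1) ^ 3 * 2) -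
              3 / 2 * (X ^ 2 * (X + 1) ^ 2) = 3 / 4 * (X + 1) ^ 2 * (3 * X + 1) := by ring
          rw [this]; positivity
    push_cast
    rw [e3]
    rw [abs_le] at ih hm ⊢
    constructor <;> linarith

open Filter Topology in
lemma zz_log_tendsto (y : ℝ) :
    Tendsto (fun n : ℕ => Real.log n - 1 / 2 * Real.log ((((n + 1 : ℕ) : ℝ) + 1) ^ 2 + y ^ 2)) atTop (𝓝 0) := by
  have h1 : Tendsto (fun n : ℕ => (1 : ℝ) / n) atTop (𝓝 0) := tendsto_one_div_atTop_nhds_zero_nat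
  have h2 : Tendsto (fun n : ℕ => (1 + 2 * ((1 : ℝ) / n)) ^ 2 + (y * ((1 : ℝ) / n)) ^ 2) atTop
      (𝓝 ((1 + 2 * 0) ^ 2 + (y * 0) ^ 2)) :=
    ((tendsto_const_nhds.add (h1.const_mul 2)).pow 2).add ((h1.const_mul y).pow 2)
  have h3 := (h2.log (by norm_num)).const_mul (-(1 / 2))
  simp at h3
  refine h3.congr' ?_
  filter_upwards [eventually_gt_atTop 0] with n hn
  have hn' : (0:ℝ) < n := by exact_mod_cast hn
  have e : (((n + 1 : ℕ) : ℝ) + 1) ^ 2 + y ^ 2 =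
      (n : ℝ) ^ 2 * ((1 + 2 * (n : ℝ)⁻¹) ^ 2 + (y * (n : ℝ)⁻¹) ^ 2) := by
    push_cast; field_simp; ring
  rw [e, Real.log_mul (by positivity) (by positivity), Real.log_pow]
  push_cast; ring

open Filter Topology in
lemma zz_digamma_bound (y : ℝ) (hy : 0 < y) :
    |Real.log y - (logDeriv Gamma (3 / 2 + y * I)).re| ≤ 7 / (8 * y ^ 2) := by
  have h1 := (Complex.continuous_re.tendsto _).comp (zz_digamma_tendsto y)
  have h2 : ∀ n : ℕ, (Complex.log n - ∑ j ∈ Finset.range (n + 1), 1 / ((3 / 2 + y * I : ℂ) + j)).re =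
      Real.log n - ∑ k ∈ Finset.range (n + 1),
        ((k : ℝ) + 3 / 2) / (((k : ℝ) + 3 / 2) ^ 2 + y ^ 2) := by
    intro n
    rw [Complex.sub_re, Complex.re_sum, ← Complex.natCast_log, Complex.ofReal_re]
    congr 1
    refine Finset.sum_congr rfl fun k _ => ?_
    rw [← zz_phi_re]
    congr 2
    push_cast; ring
  have h3 : Tendsto (fun n : ℕ => Real.log n - ∑ k ∈ Finset.range (n + 1),
        ((k : ℝ) + 3 / 2) / (((k : ℝ) + 3 / 2) ^ 2 + y ^ 2)) atTop
        (𝓝 (logDeriv Gamma (3 / 2 + y * I)).re) := h1.congr h2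
  have h4 := ((tendsto_const_nhds (x := Real.log y)).sub h3).abs
  have h5 : Tendsto (fun n : ℕ => |Real.log n - 1 / 2 * Real.log ((((n + 1 : ℕ) : ℝ) + 1) ^ 2 + y ^ 2)| +
     7 / (8 * y ^ 2)) atTop (𝓝 (|0| + 7 / (8 * y ^ 2))) := (zz_log_tendsto y).abs.add_const _
  rw [abs_zero, zero_add] at h5
  refine le_of_tendsto_of_tendsto' h4 h5 fun n => ?_
  have h6 := zz_sum_bound y hy (n + 1)
  have h7 : (0:ℝ) ≤ 1 / (((n + 1 : ℕ) : ℝ) + y) ^ 2 := by positivity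
  have h8 : 0 ≤ 1 / 2 * Real.log (1 + y ^ 2) - Real.log y ∧
      1 / 2 * Real.log (1 + y ^ 2) - Real.log y ≤ 1 / (2 * y ^ 2) := by
    have e : 1 + y ^ 2 = y ^ 2 * (1 + 1 / y ^ 2) := by field_simp; ring
    have e2 : 1 / 2 * Real.log (1 + y ^ 2) - Real.log y = 1 / 2 * Real.log (1 + 1 / y ^ 2) := by
      rw [e, Real.log_mul (by positivity) (by positivity), Real.log_pow]
      push_cast; ring
    rw [e2]
    have hp : 0 < 1 / y ^ 2 := by positivity
    have l1 : 0 ≤ Real.log (1 + 1 / y ^ 2) := Real.log_nonneg (by linarith)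
    have l2 : Real.log (1 + 1 / y ^ 2) ≤ 1 / y ^ 2 := by
      have := Real.log_le_sub_one_of_pos (show 0 < 1 + 1 / y ^ 2 by positivity)
      linarith
    have e3 : 1 / (2 * y ^ 2) = 1 / 2 * (1 / y ^ 2) := by field_simp
    rw [e3]
    constructor <;> linarith
  have e4 : 7 / (8 * y ^ 2) = 7 / 8 * (1 / y ^ 2) := by field_simp
  have e5 : 1 / (2 * y ^ 2) = 1 / 2 * (1 / y ^ 2) := by field_simp
  rw [e4]; rw [e5] at h8
  have h9 := neg_abs_le (Real.log n - 1 / 2 * Real.log ((((n + 1 : ℕ) : ℝ) + 1) ^ 2 + y ^ 2))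
  have h10 := le_abs_self (Real.log n - 1 / 2 * Real.log ((((n + 1 : ℕ) : ℝ) + 1) ^ 2 + y ^ 2))
  have h11 : 0 < 1 / y ^ 2 := by positivity
  rw [abs_le] at h6
  rw [abs_le]
  constructor <;> linarith [h8.1, h8.2, h6.1, h6.2]

open Filter Topology in
lemma zz_factor_one {f : ℂ → ℂ} (hf : Differentiable ℂ f) (a : ℂ) (hfin : analyticOrderAt f a ≠ ⊤) :
    ∃ g : ℂ → ℂ, Differentiable ℂ g ∧ g a ≠ 0 ∧
      ∀ z, f z = (z - a) ^ (analyticOrderNatAt f a) * g z := by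
  classical
  set n := analyticOrderNatAt f a with hn
  obtain ⟨g0, hg0, hg0a, he⟩ := (hf.analyticAt a).analyticOrderAt_ne_top.mp hfin
  rw [← hn] at he
  set g : ℂ → ℂ := fun z => if z = a then g0 a else f z / (z - a) ^ n with hg
  have hloc : g =ᶠ[𝓝 a] g0 := by
    filter_upwards [he] with z hz
    by_cases hza : z = a
    · simp [hg, hza]
    · have : (z - a) ^ n ≠ 0 := pow_ne_zero _ (sub_ne_zero.mpr hza)
      simp only [hg, if_neg hza, hz, smul_eq_mul]
      field_simp
  refine ⟨g, ?_, by simpa [hg] using hg0a, ?_⟩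
  · intro z
    by_cases hza : z = a
    · rw [hza]
      exact hg0.differentiableAt.congr_of_eventuallyEq hloc
    · have h1 : (z - a) ^ n ≠ 0 := pow_ne_zero _ (sub_ne_zero.mpr hza)
      have h2 : DifferentiableAt ℂ (fun z => f z / (z - a) ^ n) z :=
        (hf z).div (by fun_prop) h1
      refine h2.congr_of_eventuallyEq ?_
      filter_upwards [isOpen_ne.mem_nhds hza] with w hw
      simp only [hg]
      rw [if_neg hw]
  · intro z
    by_cases hza : z = a
    · have := he.self_of_nhds
      rw [hza, this]
      simp [hg]
    · have h1 : (z - a) ^ n ≠ 0 := pow_ne_zero _ (sub_ne_zero.mpr hza)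
      simp only [hg, if_neg hza]
      field_simp

lemma zz_factor {f : ℂ → ℂ} (hf : Differentiable ℂ f) (hfin : ∀ a, analyticOrderAt f a ≠ ⊤)
    (S : Finset ℂ) :
    ∃ g : ℂ → ℂ, Differentiable ℂ g ∧ (∀ a ∈ S, g a ≠ 0) ∧
      ∀ z, f z = (∏ a ∈ S, (z - a) ^ (analyticOrderNatAt f a)) * g z := by
  classical
  induction S using Finset.induction_on with
  | empty => exact ⟨f, hf, by simp, by simp⟩
  | insert b S hb ih =>
    obtain ⟨g, hg, hgS, hfg⟩ := ih
    have hP : Differentiable ℂ (fun z : ℂ => ∏ a ∈ S, (z - a) ^ (analyticOrderNatAt f a)) := by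
      fun_prop
    have hPb : (∏ a ∈ S, (b - a) ^ (analyticOrderNatAt f a)) ≠ 0 := by
      refine Finset.prod_ne_zero_iff.mpr fun a ha => pow_ne_zero _ (sub_ne_zero.mpr ?_)
      rintro rfl; exact hb ha
    have hord : analyticOrderAt f b = analyticOrderAt g b := by
      have h1 : f = (fun z : ℂ => ∏ a ∈ S, (z - a) ^ (analyticOrderNatAt f a)) * g := by
        funext z; exact hfg z
      have h2 : analyticOrderAt (fun z : ℂ => ∏ a ∈ S, (z - a) ^ (analyticOrderNatAt f a)) b = 0 :=
        (hP.analyticAt b).analyticOrderAt_eq_zero.mpr hPb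
      have h3 := analyticOrderAt_mul (hP.analyticAt b) (hg.analyticAt b)
      rw [← h1, h2, zero_add] at h3
      exact h3
    obtain ⟨g', hg', hg'b, hgg'⟩ := zz_factor_one hg b (hord ▸ hfin b)
    have hn : analyticOrderNatAt g b = analyticOrderNatAt f b := by
      unfold analyticOrderNatAt; rw [hord]
    refine ⟨g', hg', ?_, ?_⟩
    · intro a ha
      rcases Finset.mem_insert.mp ha with rfl | ha
      · exact hg'b
      · have := hgS a ha
        rw [hgg' a] at this
        exact right_ne_zero_of_mul this
    · intro z
      rw [Finset.prod_insert hb, hfg z, hgg' z, hn]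
      ring

open Metric Set in
/-- A zero-free entire-type estimate: the log-derivative of `G` varies slowly. -/
lemma zz_logDeriv_slow {G : ℂ → ℂ} (hG : Differentiable ℂ G) {R M : ℝ} (hR : 0 < R) (hM : 1 < M)
    (hG0 : G 0 = 1) (hne : ∀ z ∈ ball (0:ℂ) R, G z ≠ 0) (hb : ∀ z ∈ ball (0:ℂ) R, ‖G z‖ ≤ M)
    (z w : ℂ) (hz : ‖z‖ ≤ R / 8) (hw : ‖w‖ ≤ R / 8) :
    ‖logDeriv G z - logDeriv G w‖ ≤ 64 * Real.log M / R ^ 2 * ‖z - w‖ := by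
  have hlogM : 0 < Real.log M := Real.log_pos hM
  have hdl : DifferentiableOn ℂ (logDeriv G) (ball 0 R) := by
    intro x hx
    have h1 : DifferentiableAt ℂ (deriv G) x := (hG.analyticAt x).deriv.differentiableAt
    exact (h1.div (hG x) (hne x hx)).differentiableWithinAt
  obtain ⟨h, h0, hh⟩ := (hdl.isExactOn_ball).with_val_at 0 0
  have hhd : DifferentiableOn ℂ h (ball 0 R) := fun x hx =>
    (hh x hx).differentiableAt.differentiableWithinAt
  have hexp : ∀ x ∈ ball (0:ℂ) R, G x = Complex.exp (h x) := by
    have hd : ∀ x ∈ ball (0:ℂ) R, HasDerivAt (fun x => G x * Complex.exp (- h x)) 0 x := by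
      intro x hx
      have h1 := (hG x).hasDerivAt.mul ((hh x hx).neg.cexp)
      refine h1.congr_deriv ?_
      rw [logDeriv_apply]
      have := hne x hx
      simp only [Pi.neg_apply]
      field_simp
      ring
    intro x hx
    have hc := isOpen_ball.is_const_of_deriv_eq_zero (convex_ball (0:ℂ) R).isPreconnected
      (f := fun x => G x * Complex.exp (- h x))
      (fun x hx => (hd x hx).differentiableAt.differentiableWithinAt)
      (fun x hx => (hd x hx).deriv) hx (mem_ball_self hR)
    simp only [h0, hG0, neg_zero, Complex.exp_zero, mul_one] at hc
    rw [Complex.exp_neg] at hc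
    have := Complex.exp_ne_zero (h x)
    field_simp at hc
    exact hc
  have hre : MapsTo h (ball 0 R) {z | z.re ≤ Real.log M} := by
    intro x hx
    have h1 := hb x hx
    rw [hexp x hx, Complex.norm_exp] at h1
    exact (Real.le_log_iff_exp_le (by linarith)).mpr h1
  have hB : ∀ x, ‖x‖ ≤ R / 2 → ‖h x‖ ≤ 2 * Real.log M := by
    intro x hx
    have hxR : x ∈ ball (0:ℂ) R := by simp; linarith
    have h1 := Complex.borelCaratheodory_zero hlogM hhd hre hR hxR h0
    refine h1.trans ?_
    rw [div_le_iff₀ (by linarith)]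
    have := norm_nonneg x
    nlinarith
  have hsub : ∀ {x : ℂ} {r t : ℝ}, ‖x‖ ≤ t → r + t < R → closedBall x r ⊆ ball 0 R := by
    intro x r t hx hrt u hu
    rw [mem_closedBall, dist_eq_norm] at hu
    rw [mem_ball_zero_iff]
    have := norm_le_norm_sub_add u x
    linarith
  have hder : ∀ x ∈ ball (0:ℂ) R, deriv h x = logDeriv G x := fun x hx => (hh x hx).deriv
  have hB1 : ∀ x, ‖x‖ ≤ R / 4 → ‖logDeriv G x‖ ≤ 2 * Real.log M / (R / 4) := by
    intro x hx
    rw [← hder x (by simp; linarith)]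
    refine Complex.norm_deriv_le_of_forall_mem_sphere_norm_le (by linarith) ?_ ?_
    · refine DifferentiableOn.diffContOnCl ?_
      rw [closure_ball _ (by linarith)]
      exact hhd.mono (hsub hx (by linarith))
    · intro u hu
      apply hB
      rw [mem_sphere, dist_eq_norm] at hu
      have := norm_le_norm_sub_add u x
      linarith
  have hB2 : ∀ x ∈ closedBall (0:ℂ) (R / 8), ‖deriv (logDeriv G) x‖ ≤ 64 * Real.log M / R ^ 2 := by
    intro x hx
    rw [mem_closedBall_zero_iff] at hx
    have : 64 * Real.log M / R ^ 2 = 2 * Real.log M / (R / 4) / (R / 8) := by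
      field_simp; ring
    rw [this]
    refine Complex.norm_deriv_le_of_forall_mem_sphere_norm_le (by linarith) ?_ ?_
    · refine DifferentiableOn.diffContOnCl ?_
      rw [closure_ball _ (by linarith)]
      exact hdl.mono (hsub hx (by linarith))
    · intro u hu
      apply hB1
      rw [mem_sphere, dist_eq_norm] at hu
      have := norm_le_norm_sub_add u x
      linarith
  refine (convex_closedBall (0:ℂ) (R/8)).norm_image_sub_le_of_norm_deriv_le (𝕜 := ℂ) ?_ hB2
    (by simpa using hw) (by simpa using hz)
  intro x hx
  rw [mem_closedBall_zero_iff] at hx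
  exact hdl.differentiableAt (isOpen_ball.mem_nhds (by simp; linarith))

open Metric Set in
lemma zz_main_estimate {f : ℂ → ℂ} (hf : Differentiable ℂ f) (hf0 : f 0 = 1)
    (hfin : ∀ a, analyticOrderAt f a ≠ ⊤) {R M : ℝ} (hR : 0 < R) (hM : 1 < M)
    (hb : ∀ z, ‖z‖ ≤ 2 * R → ‖f z‖ ≤ M) (S : Finset ℂ) (hS : ∀ a, a ∈ S ↔ f a = 0 ∧ ‖a‖ ≤ R)
    (z w : ℂ) (hz : ‖z‖ ≤ R / 8) (hw : ‖w‖ ≤ R / 8) (hfz : f z ≠ 0) (hfw : f w ≠ 0) :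
    ‖(logDeriv f z - logDeriv f w) -
      ∑ a ∈ S, (analyticOrderNatAt f a : ℂ) * (1 / (z - a) - 1 / (w - a))‖
      ≤ 64 * Real.log M / R ^ 2 * ‖z - w‖ := by
  obtain ⟨g, hg, hgS, hfg⟩ := zz_factor hf hfin S
  set P : ℂ → ℂ := fun z => ∏ a ∈ S, (z - a) ^ (analyticOrderNatAt f a) with hPdef
  have hfg' : ∀ z, f z = P z * g z := hfg
  have hP : Differentiable ℂ P := by rw [hPdef]; fun_prop
  have hP0 : P 0 ≠ 0 := by
    have := hfg' 0
    rw [hf0] at this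
    exact left_ne_zero_of_mul (this ▸ one_ne_zero)
  set G : ℂ → ℂ := fun z => P 0 * g z with hGdef
  have hG : Differentiable ℂ G := by rw [hGdef]; fun_prop
  have hG0 : G 0 = 1 := by rw [← hf0, hfg' 0]
  have hgne : ∀ x ∈ ball (0:ℂ) R, g x ≠ 0 := by
    intro x hx
    rw [mem_ball_zero_iff] at hx
    by_cases hxS : x ∈ S
    · exact hgS x hxS
    · have : f x ≠ 0 := fun h => hxS ((hS x).mpr ⟨h, hx.le⟩)
      rw [hfg' x] at this
      exact right_ne_zero_of_mul this
  have hGb : ∀ x ∈ ball (0:ℂ) R, ‖G x‖ ≤ M := by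
    intro x hx
    refine Complex.norm_le_of_forall_mem_frontier_norm_le (U := ball (0:ℂ) (2 * R)) isBounded_ball
      hG.diffContOnCl ?_ (subset_closure (ball_subset_ball (by linarith) hx))
    intro u hu
    rw [frontier_ball _ (by linarith), mem_sphere_zero_iff_norm] at hu
    have hPP : ‖P 0‖ ≤ ‖P u‖ := by
      simp only [hPdef, norm_prod, norm_pow]
      refine Finset.prod_le_prod (fun _ _ => by positivity) fun a ha => ?_
      have ha' := ((hS a).mp ha).2
      have h1 : ‖(0:ℂ) - a‖ ≤ ‖u - a‖ := by
        have := norm_sub_norm_le u a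
        simp only [zero_sub, norm_neg]
        linarith
      gcongr
    calc ‖G u‖ = ‖P 0‖ * ‖g u‖ := by simp [hGdef]
      _ ≤ ‖P u‖ * ‖g u‖ := by gcongr
      _ = ‖f u‖ := by rw [hfg' u, norm_mul]
      _ ≤ M := hb u hu.le
  have key := zz_logDeriv_slow hG hR hM hG0
    (fun x hx => mul_ne_zero hP0 (hgne x hx)) hGb z w hz hw
  have hld : ∀ x, f x ≠ 0 → logDeriv G x =
      logDeriv f x - ∑ a ∈ S, (analyticOrderNatAt f a : ℂ) * (1 / (x - a)) := by
    intro x hx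
    have hxx := hx
    rw [hfg' x] at hxx
    have hPx := left_ne_zero_of_mul hxx
    have hgx := right_ne_zero_of_mul hxx
    have e1 : logDeriv f x = logDeriv P x + logDeriv g x := by
      have : f = fun z => P z * g z := funext hfg'
      rw [this]
      exact logDeriv_mul x hPx hgx (hP x) (hg x)
    have e2 : logDeriv G x = logDeriv g x := logDeriv_const_mul x _ hP0
    have hne : ∀ a ∈ S, (x - a) ^ (analyticOrderNatAt f a) ≠ 0 := Finset.prod_ne_zero_iff.mp hPx
    have e3 : logDeriv P x = ∑ a ∈ S, (analyticOrderNatAt f a : ℂ) * (1 / (x - a)) := by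
      rw [hPdef, logDeriv_prod hne (fun a _ => by fun_prop)]
      refine Finset.sum_congr rfl fun a ha => ?_
      rw [logDeriv_fun_pow (by fun_prop)]
      congr 1
      rw [logDeriv_apply]
      simp
    rw [e2, e1, e3]; ring
  rw [hld z hfz, hld w hfw] at key
  convert key using 2
  simp only [mul_sub, Finset.sum_sub_distrib]
  ring

open HurwitzZeta in
theorem zz_kernel_ge_one {x : ℝ} (hx : 0 < x) : 1 ≤ evenKernel 0 x := by
  have h := hasSum_int_evenKernel 0 hx
  have h2 := h.summable.le_tsum 0 (fun n _ => (Real.exp_pos _).le)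
  rw [h.tsum_eq] at h2
  simpa using h2

open HurwitzZeta in
theorem zz_f_modif_nonneg {x : ℝ} (hx : 0 < x) :
    (hurwitzEvenFEPair 0).f_modif x = ((‖(hurwitzEvenFEPair 0).f_modif x‖ : ℝ) : ℂ) := by
  have key : ∃ r : ℝ, 0 ≤ r ∧ (hurwitzEvenFEPair 0).f_modif x = (r : ℂ) := by
    rcases lt_trichotomy x 1 with h | h | h
    · refine ⟨evenKernel 0 x - x ^ (-(1/2) : ℝ), ?_, ?_⟩
      · have h1 := evenKernel_functional_equation 0 x
        rw [← evenKernel_eq_cosKernel_of_zero] at h1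
        have h2 : 1 ≤ evenKernel 0 (1 / x) := zz_kernel_ge_one (by positivity)
        have h3 : 0 < x ^ (1/2 : ℝ) := by positivity
        rw [h1, Real.rpow_neg hx.le]
        have : (x ^ (1/2 : ℝ))⁻¹ * 1 ≤ (x ^ (1/2 : ℝ))⁻¹ * evenKernel 0 (1 / x) :=
          mul_le_mul_of_nonneg_left h2 (by positivity)
        rw [one_div (x ^ (1/2 : ℝ))]
        linarith
      · simp only [WeakFEPair.f_modif, Pi.add_apply]
        rw [Set.indicator_of_notMem (by simp [h.le]), Set.indicator_of_mem (by simp [h, hx])]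
        simp [hurwitzEvenFEPair]
    · refine ⟨0, le_rfl, ?_⟩
      simp [WeakFEPair.f_modif, h]
    · refine ⟨evenKernel 0 x - 1, by linarith [zz_kernel_ge_one hx], ?_⟩
      simp only [WeakFEPair.f_modif, Pi.add_apply]
      rw [Set.indicator_of_mem (by simp [h]), Set.indicator_of_notMem (by simp [h.le])]
      simp [hurwitzEvenFEPair]
  obtain ⟨r, hr, h⟩ := key
  rw [h, Complex.norm_real, Real.norm_of_nonneg hr]

open HurwitzZeta MeasureTheory in
theorem zz_mellin_conv (s : ℂ) : MellinConvergent (hurwitzEvenFEPair 0).f_modif s :=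
  ((hurwitzEvenFEPair 0).isStrongFEPair_toStrongFEPair.hasMellin s).1

open HurwitzZeta MeasureTheory in
theorem zz_norm_integrable (b : ℝ) :
    IntegrableOn (fun x : ℝ => x ^ (b - 1) * ‖(hurwitzEvenFEPair 0).f_modif x‖) (Set.Ioi 0) := by
  have h := (zz_mellin_conv b).norm
  refine (integrableOn_congr_fun ?_ measurableSet_Ioi).mp h
  intro x hx
  simp only [norm_smul]
  rw [Complex.norm_cpow_eq_rpow_re_of_pos hx]
  simp

open HurwitzZeta MeasureTheory in
theorem zz_norm_integral (b : ℝ) :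
    ∫ x in Set.Ioi (0:ℝ), x ^ (b - 1) * ‖(hurwitzEvenFEPair 0).f_modif x‖ =
      ‖(hurwitzEvenFEPair 0).Λ₀ b‖ := by
  have h : (hurwitzEvenFEPair 0).Λ₀ b =
      ((∫ x in Set.Ioi (0:ℝ), x ^ (b - 1) * ‖(hurwitzEvenFEPair 0).f_modif x‖ : ℝ) : ℂ) := by
    rw [← integral_complex_ofReal]
    unfold WeakFEPair.Λ₀ mellin
    refine setIntegral_congr_fun measurableSet_Ioi (fun x hx => ?_)
    have hx' : 0 < x := hx
    simp only [smul_eq_mul]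
    rw [zz_f_modif_nonneg hx']
    push_cast
    rw [Complex.ofReal_cpow hx'.le]
    simp
  rw [h, Complex.norm_real, Real.norm_of_nonneg]
  exact setIntegral_nonneg measurableSet_Ioi
    (fun x hx => mul_nonneg (Real.rpow_nonneg (le_of_lt hx) _) (norm_nonneg _))

open HurwitzZeta MeasureTheory in
theorem zz_Lambda_bound (s : ℂ) (b c : ℝ) (hc : c ≤ s.re) (hb : s.re ≤ b) :
    ‖(hurwitzEvenFEPair 0).Λ₀ s‖ ≤
      ‖(hurwitzEvenFEPair 0).Λ₀ b‖ + ‖(hurwitzEvenFEPair 0).Λ₀ c‖ := by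
  rw [← zz_norm_integral b, ← zz_norm_integral c,
    ← integral_add (zz_norm_integrable b) (zz_norm_integrable c)]
  unfold WeakFEPair.Λ₀ mellin
  refine norm_integral_le_of_norm_le ((zz_norm_integrable b).add (zz_norm_integrable c)) ?_
  refine (ae_restrict_iff' measurableSet_Ioi).mpr (Filter.Eventually.of_forall fun x hx => ?_)
  have hx' : 0 < x := hx
  rw [norm_smul, Complex.norm_cpow_eq_rpow_re_of_pos hx']
  simp only [Pi.add_apply, Complex.sub_re, Complex.one_re]
  rw [← add_mul]
  refine mul_le_mul_of_nonneg_right ?_ (norm_nonneg _)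
  have p1 : 0 < x ^ (b - 1) := by positivity
  have p2 : 0 < x ^ (c - 1) := by positivity
  rcases le_total 1 x with h | h
  · have := Real.rpow_le_rpow_of_exponent_le h (by linarith : s.re - 1 ≤ b - 1)
    linarith
  · have := Real.rpow_le_rpow_of_exponent_ge hx' h (by linarith : c - 1 ≤ s.re - 1)
    linarith

open HurwitzZeta in
theorem zz_completed_bound (s : ℂ) (A : ℝ) (h1 : 1 - A ≤ s.re) (h2 : s.re ≤ A) :
    ‖completedRiemannZeta₀ s‖ ≤ 2 * ‖completedRiemannZeta₀ A‖ := by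
  have h3 : ‖completedRiemannZeta₀ (1 - A)‖ = ‖completedRiemannZeta₀ A‖ := by
    rw [completedRiemannZeta₀_one_sub]
  have h4 := zz_Lambda_bound (s / 2) (A / 2) ((1 - A) / 2)
    (by rw [Complex.div_ofNat_re]; linarith) (by rw [Complex.div_ofNat_re]; linarith)
  simp only [completedRiemannZeta₀, completedHurwitzZetaEven₀, norm_div] at h3 ⊢
  push_cast at h4
  have h5 : ‖(2:ℂ)‖ = 2 := by simp
  rw [h5] at h3 ⊢
  linarith

/-- the entire completed function -/
noncomputable def zzXi (s : ℂ) : ℂ := s * (s - 1) * completedRiemannZeta₀ s + 1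

theorem zz_completed_even_bound : ∃ C : ℝ, 0 ≤ C ∧ ∀ n : ℕ,
    ‖completedRiemannZeta₀ ((2 * n + 2 : ℝ) : ℂ)‖ ≤ C * (n.factorial : ℝ) + 2 := by
  have hs : Summable (fun k : ℕ => 1 / (k : ℝ) ^ 2) := Real.summable_one_div_nat_pow.mpr (by norm_num)
  refine ⟨∑' k : ℕ, 1 / (k : ℝ) ^ 2, tsum_nonneg (fun k => by positivity), fun n => ?_⟩
  set s : ℂ := ((2 * n + 2 : ℝ) : ℂ) with hsdef
  have hre : s.re = 2 * n + 2 := by simp [hsdef]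
  have hn : (0:ℝ) ≤ n := Nat.cast_nonneg n
  have h1 := completedRiemannZeta_eq s
  have h2 := completedZeta_eq_tsum_of_one_lt_re (s := s) (by rw [hre]; linarith)
  have h3 : completedRiemannZeta₀ s = (Real.pi : ℂ) ^ (-s / 2) * Gamma (s / 2) *
      (∑' n : ℕ, 1 / (n : ℂ) ^ s) + (1 / s + 1 / (1 - s)) := by
    rw [← h2, h1]; ring
  have hG : Gamma (s / 2) = n.factorial := by
    rw [← Complex.Gamma_nat_eq_factorial]
    congr 1
    rw [hsdef]; push_cast; ring
  have hpi : ‖(Real.pi : ℂ) ^ (-s / 2)‖ ≤ 1 := by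
    rw [Complex.norm_cpow_eq_rpow_re_of_pos Real.pi_pos]
    refine Real.rpow_le_one_of_one_le_of_nonpos (by linarith [Real.pi_gt_three]) ?_
    rw [Complex.div_ofNat_re, Complex.neg_re, hre]; linarith
  have hz : ‖∑' n : ℕ, 1 / (n : ℂ) ^ s‖ ≤ ∑' k : ℕ, 1 / (k : ℝ) ^ 2 := by
    refine tsum_of_norm_bounded hs.hasSum (fun k => ?_)
    rcases Nat.eq_zero_or_pos k with rfl | hk
    · have : s ≠ 0 := by intro h; rw [h] at hre; simp at hre; linarith
      simp [Complex.zero_cpow this]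
    · rw [norm_div, norm_one, Complex.norm_natCast_cpow_of_pos hk, hre]
      refine one_div_le_one_div_of_le (by positivity) ?_
      rw [← Real.rpow_natCast (k:ℝ) 2]
      refine Real.rpow_le_rpow_of_exponent_le (by exact_mod_cast hk) ?_
      push_cast; linarith
  have e1 : ‖1 / s‖ ≤ 1 := by
    rw [norm_div, norm_one, hsdef, Complex.norm_real, Real.norm_of_nonneg (by linarith),
      div_le_one (by linarith)]; linarith
  have e2 : ‖1 / (1 - s)‖ ≤ 1 := by
    have : (1 - s) = ((-(2 * n + 1) : ℝ) : ℂ) := by rw [hsdef]; push_cast; ring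
    rw [norm_div, norm_one, this, Complex.norm_real, norm_neg, Real.norm_of_nonneg (by linarith),
      div_le_one (by linarith)]; linarith
  rw [h3]
  refine (norm_add_le _ _).trans (add_le_add ?_ ((norm_add_le _ _).trans (by linarith)))
  rw [norm_mul, norm_mul, hG, Complex.norm_natCast, mul_comm]
  refine mul_le_mul hz ?_ (by positivity) (tsum_nonneg (fun k => by positivity))
  exact mul_le_of_le_one_left (by positivity) hpi

theorem zz_Xi_growth : ∃ K : ℝ, 1 < K ∧ ∀ n : ℕ, ∀ s : ℂ, ‖s‖ ≤ 2 * n →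
    ‖zzXi s‖ ≤ K * (n + 1 : ℝ) ^ (n + 2) := by
  obtain ⟨C, hC, h⟩ := zz_completed_even_bound
  refine ⟨8 * (C + 2) + 1, by linarith, fun n s hs => ?_⟩
  have hn : (0:ℝ) ≤ n := Nat.cast_nonneg n
  have hre := (abs_le.mp (Complex.abs_re_le_norm s))
  have hb := zz_completed_bound s (2 * n + 2) (by linarith) (by linarith)
  have hf : (n.factorial : ℝ) ≤ (n + 1 : ℝ) ^ n := by
    have h1 : n.factorial ≤ n ^ n := Nat.factorial_le_pow n
    calc (n.factorial : ℝ) ≤ (n:ℝ) ^ n := by exact_mod_cast h1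
      _ ≤ _ := by gcongr; linarith
  have hone : (1:ℝ) ≤ (n + 1 : ℝ) ^ n := one_le_pow₀ (by linarith)
  have hone2 : (1:ℝ) ≤ (n + 1 : ℝ) ^ (n + 2) := one_le_pow₀ (by linarith)
  have hb2 : ‖completedRiemannZeta₀ s‖ ≤ 2 * ((C + 2) * (n + 1 : ℝ) ^ n) := by
    have := h n
    have : C * (n.factorial : ℝ) ≤ C * (n + 1 : ℝ) ^ n := by gcongr
    nlinarith [h n]
  have hs1 : ‖s - 1‖ ≤ 2 * n + 1 := (norm_sub_le _ _).trans (by rw [norm_one]; linarith)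
  have hp : ‖s * (s - 1)‖ ≤ 4 * (n + 1 : ℝ) ^ 2 := by
    rw [norm_mul]
    calc ‖s‖ * ‖s - 1‖ ≤ (2 * n) * (2 * n + 1) := by gcongr
      _ ≤ _ := by nlinarith
  unfold zzXi
  refine (norm_add_le _ _).trans ?_
  rw [norm_mul, norm_one]
  calc ‖s * (s - 1)‖ * ‖completedRiemannZeta₀ s‖ + 1
      ≤ (4 * (n + 1 : ℝ) ^ 2) * (2 * ((C + 2) * (n + 1 : ℝ) ^ n)) + (n + 1 : ℝ) ^ (n + 2) := by
        gcongr
    _ = _ := by ring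

open Filter Topology in
theorem zz_log_growth (K : ℝ) (hK : 1 < K) (c : ℝ) :
    Tendsto (fun n : ℕ => 64 * Real.log (K * (n + 1 : ℝ) ^ (n + 2)) / (n:ℝ) ^ 2 * c) atTop (𝓝 0) := by
  have hlog : Tendsto (fun n : ℕ => Real.log (n + 1 : ℝ) / (n + 1 : ℝ)) atTop (𝓝 0) := by
    have h := Real.isLittleO_log_id_atTop.tendsto_div_nhds_zero
    exact (h.comp (tendsto_atTop_add_const_right atTop (1:ℝ) tendsto_natCast_atTop_atTop)).congr
      (fun n => by simp)
  have hinv : Tendsto (fun n : ℕ => 1 / (n : ℝ)) atTop (𝓝 0) := tendsto_one_div_atTop_nhds_zero_nat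
  have h1 : Tendsto (fun n : ℕ => 64 * (Real.log K * (1 / (n:ℝ)) ^ 2 +
      (1 + 2 * (1 / (n:ℝ))) * (1 + 1 / (n:ℝ)) * (Real.log (n + 1 : ℝ) / (n + 1 : ℝ))) * c)
      atTop (𝓝 (64 * (Real.log K * 0 ^ 2 + (1 + 2 * 0) * (1 + 0) * 0) * c)) := by
    refine Tendsto.mul_const _ (Tendsto.const_mul _ (((hinv.pow 2).const_mul _).add ?_))
    exact (((hinv.const_mul 2).const_add 1).mul (hinv.const_add 1)).mul hlog
  simp only [ne_eq, OfNat.ofNat_ne_zero, not_false_eq_true, zero_pow, mul_zero, add_zero,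
    zero_mul] at h1
  refine h1.congr' ?_
  filter_upwards [eventually_gt_atTop 0] with n hn
  have hn' : (0:ℝ) < n := by exact_mod_cast hn
  rw [Real.log_mul (by linarith) (by positivity), Real.log_pow]
  push_cast
  field_simp

theorem zzXi_diff : Differentiable ℂ zzXi := by
  unfold zzXi
  have := differentiable_completedZeta₀
  fun_prop

theorem zzXi_zero : zzXi 0 = 1 := by simp [zzXi]

theorem zzXi_one_sub (s : ℂ) : zzXi (1 - s) = zzXi s := by
  simp only [zzXi, completedRiemannZeta₀_one_sub]; ring

theorem zzXi_order_ne_top (a : ℂ) : analyticOrderAt zzXi a ≠ ⊤ := by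
  intro h
  have han : ∀ z, AnalyticAt ℂ zzXi z := fun z => zzXi_diff.analyticAt z
  have h2 := AnalyticOnNhd.eqOn_zero_of_preconnected_of_eventuallyEq_zero
    (fun z _ => han z) isPreconnected_univ (Set.mem_univ a) (analyticOrderAt_eq_top.mp h)
  have := h2 (Set.mem_univ 0)
  rw [zzXi_zero] at this
  simp at this

theorem zzXi_eq {s : ℂ} (hs : 0 < s.re) (hs1 : s ≠ 1) :
    zzXi s = s * (s - 1) * Gammaℝ s * riemannZeta s := by
  have hs0 : s ≠ 0 := by rintro rfl; simp at hs
  have hG := Gammaℝ_ne_zero_of_re_pos hs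
  have h1 : (1 - s) ≠ 0 := sub_ne_zero.mpr (Ne.symm hs1)
  rw [riemannZeta_def_of_ne_zero hs0, completedRiemannZeta_eq, zzXi]
  field_simp
  ring

theorem zzXi_ne_zero_of_one_le {s : ℂ} (hs : 1 ≤ s.re) : zzXi s ≠ 0 := by
  by_cases h1 : s = 1
  · rw [h1]; simp [zzXi]
  · have hs0 : s ≠ 0 := by rintro rfl; simp at hs; linarith
    rw [zzXi_eq (by linarith) h1]
    exact mul_ne_zero (mul_ne_zero (mul_ne_zero hs0 (sub_ne_zero.mpr h1))
      (Gammaℝ_ne_zero_of_re_pos (by linarith))) (riemannZeta_ne_zero_of_one_le_re hs)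

theorem zzXi_eq_zero_iff (a : ℂ) : zzXi a = 0 ↔ a ∈ zetaNontrivialZeros := by
  constructor
  · intro h
    have h1 : a.re < 1 := by
      by_contra hc
      exact zzXi_ne_zero_of_one_le (not_lt.mp hc) h
    have h0 : 0 < a.re := by
      by_contra hc
      refine zzXi_ne_zero_of_one_le (s := 1 - a) ?_ (by rw [zzXi_one_sub, h])
      simp; linarith
    have ha1 : a ≠ 1 := by rintro rfl; simp at h1
    have hs0 : a ≠ 0 := by rintro rfl; simp at h0
    rw [zzXi_eq h0 ha1] at h
    refine ⟨?_, h0, h1⟩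
    have := mul_ne_zero (mul_ne_zero hs0 (sub_ne_zero.mpr ha1)) (Gammaℝ_ne_zero_of_re_pos h0)
    exact (mul_eq_zero.mp h).resolve_left this
  · rintro ⟨hz, h0, h1⟩
    have ha1 : a ≠ 1 := by rintro rfl; simp at h1
    rw [zzXi_eq h0 ha1, hz, mul_zero]

open Filter Topology in
theorem zzXi_order {a : ℂ} (ha : a ∈ zetaNontrivialZeros) :
    analyticOrderNatAt zzXi a = zetaZeroMult a := by
  obtain ⟨hz, h0, h1⟩ := ha
  have ha1 : a ≠ 1 := by rintro rfl; simp at h1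
  have ha0 : a ≠ 0 := by rintro rfl; simp at h0
  have hopen : IsOpen {s : ℂ | 0 < s.re ∧ s ≠ 1} :=
    (isOpen_lt continuous_const Complex.continuous_re).inter isOpen_ne
  have hmem : {s : ℂ | 0 < s.re ∧ s ≠ 1} ∈ 𝓝 a := hopen.mem_nhds ⟨h0, ha1⟩
  set h : ℂ → ℂ := fun s => (Gammaℝ s)⁻¹ * (s * (s - 1))⁻¹ with hh
  have hdiff : DifferentiableOn ℂ h {s : ℂ | 0 < s.re ∧ s ≠ 1} := by
    rintro s ⟨hs0, hs1⟩
    have : s ≠ 0 := by rintro rfl; simp at hs0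
    refine DifferentiableAt.differentiableWithinAt ?_
    refine (differentiable_Gammaℝ_inv s).mul (DifferentiableAt.inv (by fun_prop) ?_)
    exact mul_ne_zero this (sub_ne_zero.mpr hs1)
  have hhan : AnalyticAt ℂ h a := hdiff.analyticAt hmem
  have hha : h a ≠ 0 := mul_ne_zero (inv_ne_zero (Gammaℝ_ne_zero_of_re_pos h0))
    (inv_ne_zero (mul_ne_zero ha0 (sub_ne_zero.mpr ha1)))
  have hev : riemannZeta =ᶠ[𝓝 a] h * zzXi := by
    filter_upwards [hmem] with s hs
    obtain ⟨hs0, hs1⟩ := hs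
    have h0' : s ≠ 0 := by rintro rfl; simp at hs0
    have hG := Gammaℝ_ne_zero_of_re_pos hs0
    have hs1' := sub_ne_zero.mpr hs1
    rw [Pi.mul_apply, zzXi_eq hs0 hs1, hh]
    field_simp
  have hord : analyticOrderAt riemannZeta a = analyticOrderAt zzXi a := by
    rw [analyticOrderAt_congr hev, analyticOrderAt_mul hhan (zzXi_diff.analyticAt a),
      hhan.analyticOrderAt_eq_zero.mpr hha, zero_add]
  have hzan : AnalyticAt ℂ riemannZeta a :=
    (analyticAt_congr hev).mpr (hhan.mul (zzXi_diff.analyticAt a))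
  have hn : analyticOrderAt riemannZeta a = (analyticOrderNatAt zzXi a : ℕ) := by
    rw [hord]; exact (Nat.cast_analyticOrderNatAt (zzXi_order_ne_top a)).symm
  obtain ⟨hlt, hne⟩ := (analyticOrderAt_eq_nat_iff_iteratedDeriv_eq_zero hzan).mp hn
  unfold zetaZeroMult
  refine le_antisymm ?_ (Nat.sInf_le hne)
  refine le_csInf ⟨_, hne⟩ (fun m hm => ?_)
  by_contra hc
  exact hm (hlt m (not_le.mp hc))

theorem zz_one_sub_mem {a : ℂ} (ha : a ∈ zetaNontrivialZeros) : 1 - a ∈ zetaNontrivialZeros := by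
  rw [← zzXi_eq_zero_iff] at ha ⊢
  rw [zzXi_one_sub, ha]

theorem zz_mult_one_sub {a : ℂ} (ha : a ∈ zetaNontrivialZeros) :
    zetaZeroMult (1 - a) = zetaZeroMult a := by
  rw [← zzXi_order ha, ← zzXi_order (zz_one_sub_mem ha)]
  have h1 : zzXi ∘ (fun s : ℂ => 1 - s) = zzXi := by funext s; exact zzXi_one_sub s
  have hg : AnalyticAt ℂ (fun s : ℂ => 1 - s) a := by fun_prop
  have hd : deriv (fun s : ℂ => 1 - s) a ≠ 0 := by simp
  have := analyticOrderAt_comp_of_deriv_ne_zero (f := zzXi) hg hd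
  rw [h1] at this
  unfold analyticOrderNatAt
  rw [this]

theorem zz_finite (R : ℝ) : {a : ℂ | zzXi a = 0 ∧ ‖a‖ ≤ R}.Finite := by
  refine (IsCompact.inter_riemannZetaZeros_finite (isCompact_closedBall (0:ℂ) R)).subset ?_
  rintro a ⟨h1, h2⟩
  refine ⟨by simpa using h2, ?_⟩
  exact ((zzXi_eq_zero_iff a).mp h1).1

theorem zz_logDeriv_one_sub (s : ℂ) : logDeriv zzXi (1 - s) = - logDeriv zzXi s := by
  have h1 : (fun s : ℂ => zzXi (1 - s)) = zzXi := by funext s; exact zzXi_one_sub s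
  have h2 := deriv_comp_const_sub (f := zzXi) (1:ℂ) s
  rw [h1] at h2
  rw [logDeriv_apply, logDeriv_apply, zzXi_one_sub, h2]
  ring

open Filter Topology in
theorem zz_logDeriv_Xi {s : ℂ} (hs : 1 ≤ s.re) (hs1 : s ≠ 1) :
    logDeriv zzXi s = 1 / (s - 1) - (1 / 2) * Complex.log Real.pi +
      (1 / 2) * logDeriv Gamma (s / 2 + 1) + logDeriv riemannZeta s := by
  have hopen : IsOpen {s : ℂ | 0 < s.re ∧ s ≠ 1} :=
    (isOpen_lt continuous_const Complex.continuous_re).inter isOpen_ne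
  have hmem : {s : ℂ | 0 < s.re ∧ s ≠ 1} ∈ 𝓝 s := hopen.mem_nhds ⟨by linarith, hs1⟩
  have hpi : (Real.pi : ℂ) ≠ 0 := by exact_mod_cast Real.pi_ne_zero
  have hev : zzXi =ᶠ[𝓝 s] fun s => (2 * (s - 1)) * ((Real.pi : ℂ) ^ (-s / 2) *
      (Gamma (s / 2 + 1) * riemannZeta s)) := by
    filter_upwards [hmem] with w hw
    obtain ⟨h0, h1⟩ := hw
    have hw0 : w ≠ 0 := by rintro rfl; simp at h0
    rw [zzXi_eq h0 h1, Gammaℝ_def, Gamma_add_one _ (div_ne_zero hw0 two_ne_zero)]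
    ring
  have hre : 0 < (s / 2 + 1).re := by
    rw [Complex.add_re, Complex.div_ofNat_re, Complex.one_re]; linarith
  have hGd : DifferentiableAt ℂ Gamma (s / 2 + 1) := by
    refine differentiableAt_Gamma _ (fun m hm => ?_)
    rw [hm] at hre
    simp at hre
    have : (0:ℝ) ≤ m := Nat.cast_nonneg m
    linarith
  have hG0 : Gamma (s / 2 + 1) ≠ 0 := Gamma_ne_zero_of_re_pos hre
  have hz0 : riemannZeta s ≠ 0 := riemannZeta_ne_zero_of_one_le_re hs
  have hzd : DifferentiableAt ℂ riemannZeta s := differentiableAt_riemannZeta hs1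
  have hGc : DifferentiableAt ℂ (fun s : ℂ => Gamma (s / 2 + 1)) s :=
    DifferentiableAt.comp (f := fun s : ℂ => s / 2 + 1) (g := Gamma) s hGd (by fun_prop)
  have hp0 : (Real.pi : ℂ) ^ (-s / 2) ≠ 0 := by simp [Complex.cpow_eq_zero_iff, hpi]
  have hpd : HasDerivAt (fun s : ℂ => (Real.pi : ℂ) ^ (-s / 2))
      ((Real.pi : ℂ) ^ (-s / 2) * Complex.log Real.pi * (-1 / 2)) s := by
    have : HasDerivAt (fun s : ℂ => -s / 2) (-1 / 2) s := ((hasDerivAt_id s).neg).div_const 2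
    exact this.const_cpow (Or.inl hpi)
  have h2 : (2 * (s - 1)) ≠ 0 := mul_ne_zero two_ne_zero (sub_ne_zero.mpr hs1)
  have hlin : HasDerivAt (fun s : ℂ => 2 * (s - 1)) 2 s := by
    simpa using ((hasDerivAt_id s).sub_const 1).const_mul 2
  have hGl : logDeriv (fun s : ℂ => Gamma (s / 2 + 1)) s = (1 / 2) * logDeriv Gamma (s / 2 + 1) := by
    have h3 : HasDerivAt (fun s : ℂ => s / 2 + 1) (1 / 2) s :=
      ((hasDerivAt_id s).div_const 2).add_const 1
    have h4 := HasDerivAt.comp s (h := fun s : ℂ => s / 2 + 1) hGd.hasDerivAt h3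
    rw [logDeriv_apply, logDeriv_apply]
    rw [show (fun s : ℂ => Gamma (s / 2 + 1)) = Gamma ∘ (fun s : ℂ => s / 2 + 1) from rfl, h4.deriv]
    ring
  have e0 : logDeriv zzXi s = logDeriv (fun s => (2 * (s - 1)) * ((Real.pi : ℂ) ^ (-s / 2) *
      (Gamma (s / 2 + 1) * riemannZeta s))) s := by
    rw [logDeriv_apply, logDeriv_apply, hev.deriv_eq, hev.self_of_nhds]
  rw [e0, logDeriv_mul (f := fun s : ℂ => 2 * (s - 1))
      (g := fun s : ℂ => (Real.pi : ℂ) ^ (-s / 2) * (Gamma (s / 2 + 1) * riemannZeta s)) s h2 (mul_ne_zero hp0 (mul_ne_zero hG0 hz0))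
      hlin.differentiableAt (hpd.differentiableAt.mul (hGc.mul hzd)),
    logDeriv_mul (f := fun s : ℂ => (Real.pi : ℂ) ^ (-s / 2))
      (g := fun s : ℂ => Gamma (s / 2 + 1) * riemannZeta s) s hp0 (mul_ne_zero hG0 hz0)
      hpd.differentiableAt (hGc.mul hzd),
    logDeriv_mul (f := fun s : ℂ => Gamma (s / 2 + 1)) s hG0 hz0 hGc hzd, hGl]
  rw [logDeriv_apply (fun s : ℂ => 2 * (s - 1)), hlin.deriv,
    logDeriv_apply (fun s : ℂ => (Real.pi : ℂ) ^ (-s / 2)), hpd.deriv]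
  have hs1' := sub_ne_zero.mpr hs1
  field_simp
  ring

theorem zz_rh_re (RH : RiemannHypothesis) {a : ℂ} (ha : a ∈ zetaNontrivialZeros) : a.re = 1 / 2 := by
  obtain ⟨h, h0, h1⟩ := ha
  refine RH a h ?_ ?_
  · rintro ⟨n, hn⟩
    have h2 := congrArg Complex.re hn
    simp at h2
    have : (0:ℝ) ≤ n := Nat.cast_nonneg n
    rw [h2] at h0
    linarith
  · rintro rfl; simp at h1

theorem zz_re_terms {a : ℂ} (ha : a.re = 1 / 2) (t : ℝ) :
    (1 / ((1 + t * I) - a) - 1 / ((1 - (1 + t * I)) - a)).re =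
      (1 / 2) / (1 / 4 + (t - a.im) ^ 2) + (1 / 2) / (1 / 4 + (t + a.im) ^ 2) := by
  have h1 : (1 / 4 + (t - a.im) ^ 2) ≠ 0 := by positivity
  have h2 : (1 / 4 + (t + a.im) ^ 2) ≠ 0 := by positivity
  simp only [one_div, Complex.sub_re, Complex.inv_re, Complex.normSq_apply]
  simp only [Complex.sub_re, Complex.sub_im, Complex.add_re, Complex.add_im, Complex.one_re,
    Complex.one_im, Complex.mul_re, Complex.mul_im, Complex.ofReal_re, Complex.ofReal_im,
    Complex.I_re, Complex.I_im, ha]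
  have e1 : (1 + (t * 0 - 0 * 1) - 1 / 2) * (1 + (t * 0 - 0 * 1) - 1 / 2) +
      (0 + (t * 1 + 0 * 0) - a.im) * (0 + (t * 1 + 0 * 0) - a.im) = 1 / 4 + (t - a.im) ^ 2 := by ring
  have e2 : (1 - (1 + (t * 0 - 0 * 1)) - 1 / 2) * (1 - (1 + (t * 0 - 0 * 1)) - 1 / 2) +
      (0 - (0 + (t * 1 + 0 * 0)) - a.im) * (0 - (0 + (t * 1 + 0 * 0)) - a.im)
      = 1 / 4 + (t + a.im) ^ 2 := by ring
  rw [e1, e2]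
  ring

open Filter Topology in
theorem zz_sum_eq (RH : RiemannHypothesis) (t : ℝ) :
    (∑' ρ : zetaNontrivialZeros,
      (zetaZeroMult ρ : ℝ) * ((1 / 2) / (1 / 4 + (t - (ρ : ℂ).im) ^ 2))) =
      (logDeriv zzXi (1 + t * I)).re := by
  classical
  set z : ℂ := 1 + t * I with hz
  set L : ℝ := 2 * (logDeriv zzXi z).re with hL
  have hzre : z.re = 1 := by simp [hz]
  have hfz : zzXi z ≠ 0 := zzXi_ne_zero_of_one_le hzre.ge
  have hfw : zzXi (1 - z) ≠ 0 := by rw [zzXi_one_sub]; exact hfz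
  set G : ℂ → ℝ := fun a => (zetaZeroMult a : ℝ) *
    ((1 / 2) / (1 / 4 + (t - a.im) ^ 2) + (1 / 2) / (1 / 4 + (t + a.im) ^ 2)) with hG
  have hG0 : ∀ a, 0 ≤ G a := fun a => by simp only [hG]; positivity
  set S : ℕ → Finset ℂ := fun n => (zz_finite n).toFinset with hS
  have hSmem : ∀ n a, a ∈ S n ↔ zzXi a = 0 ∧ ‖a‖ ≤ n := fun n a => by simp [hS]
  set T : ℕ → Finset zetaNontrivialZeros := fun n => (S n).subtype (· ∈ zetaNontrivialZeros) with hT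
  have hTmem : ∀ n (a : zetaNontrivialZeros), a ∈ T n ↔ ‖(a : ℂ)‖ ≤ n := fun n a => by
    simp only [hT, Finset.mem_subtype, hSmem]
    exact and_iff_right ((zzXi_eq_zero_iff a).mpr a.2)
  have hTS : ∀ n, ∑ a ∈ T n, G a = ∑ a ∈ S n, G a := fun n =>
    Finset.sum_subtype_of_mem G (fun a ha => (zzXi_eq_zero_iff a).mp ((hSmem n a).mp ha).1)
  have hTmono : Monotone T := fun m n hmn a ha => by
    rw [hTmem] at ha ⊢
    exact ha.trans (by exact_mod_cast hmn)
  have hTtop : Tendsto T atTop atTop := by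
    refine tendsto_atTop_finset_of_monotone hTmono (fun a => ?_)
    obtain ⟨n, hn⟩ := exists_nat_ge ‖(a : ℂ)‖
    exact ⟨n, (hTmem n a).mpr hn⟩
  obtain ⟨K, hK, hgrow⟩ := zz_Xi_growth
  have hlim : Tendsto (fun n => ∑ a ∈ T n, G a) atTop (𝓝 L) := by
    rw [tendsto_iff_norm_sub_tendsto_zero]
    refine squeeze_zero' (Eventually.of_forall fun n => norm_nonneg _) ?_
      (zz_log_growth K hK ‖z - (1 - z)‖)
    obtain ⟨N, hN⟩ := exists_nat_ge (8 * ‖z‖ + 8 * ‖1 - z‖ + 1)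
    filter_upwards [eventually_ge_atTop N] with n hn
    have hn' : 8 * ‖z‖ + 8 * ‖1 - z‖ + 1 ≤ (n : ℝ) := hN.trans (by exact_mod_cast hn)
    have p1 := norm_nonneg z
    have p2 := norm_nonneg (1 - z)
    have hM : 1 < K * (n + 1 : ℝ) ^ (n + 2) := by
      have : (1:ℝ) ≤ (n + 1 : ℝ) ^ (n + 2) := one_le_pow₀ (by linarith)
      nlinarith
    have hest := zz_main_estimate zzXi_diff zzXi_zero zzXi_order_ne_top (R := n) (by linarith) hM
      (hgrow n) (S n) (hSmem n) z (1 - z) (by linarith) (by linarith) hfz hfw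
    refine le_trans ?_ hest
    rw [hTS n, Real.norm_eq_abs, abs_sub_comm]
    refine le_trans (le_of_eq ?_) (Complex.abs_re_le_norm _)
    congr 1
    rw [zz_logDeriv_one_sub, Complex.sub_re, Complex.re_sum, hL]
    congr 1
    · simp; ring
    · refine Finset.sum_congr rfl (fun a ha => ?_)
      have ha' := (zzXi_eq_zero_iff a).mp ((hSmem n a).mp ha).1
      rw [zzXi_order ha', ← Complex.ofReal_natCast, Complex.re_ofReal_mul,
        zz_re_terms (zz_rh_re RH ha') t]
  have hle : ∀ n, ∑ a ∈ T n, G a ≤ L := by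
    intro n
    refine Monotone.ge_of_tendsto (f := fun n => ∑ a ∈ T n, G a) ?_ hlim n
    intro m n hmn
    exact Finset.sum_le_sum_of_subset_of_nonneg (hTmono hmn) (fun a _ _ => hG0 a)
  have hsum : Summable (fun a : zetaNontrivialZeros => G a) := by
    refine summable_of_sum_le (c := L) (fun a => hG0 a) (fun u => ?_)
    obtain ⟨n, hn⟩ := (hTtop.eventually (eventually_ge_atTop u)).exists
    exact (Finset.sum_le_sum_of_subset_of_nonneg hn (fun a _ _ => hG0 a)).trans (hle n)
  have htsum : ∑' a : zetaNontrivialZeros, G a = L :=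
    tendsto_nhds_unique (hsum.hasSum.comp hTtop) hlim
  set A : zetaNontrivialZeros → ℝ := fun ρ =>
    (zetaZeroMult ρ : ℝ) * ((1 / 2) / (1 / 4 + (t - (ρ : ℂ).im) ^ 2)) with hA
  set B : zetaNontrivialZeros → ℝ := fun ρ =>
    (zetaZeroMult ρ : ℝ) * ((1 / 2) / (1 / 4 + (t + (ρ : ℂ).im) ^ 2)) with hB
  have hGAB : ∀ a : zetaNontrivialZeros, G a = A a + B a := fun a => by
    simp only [hG, hA, hB]; ring
  have hA0 : ∀ a, 0 ≤ A a := fun a => by simp only [hA]; positivity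
  have hB0 : ∀ a, 0 ≤ B a := fun a => by simp only [hB]; positivity
  have hAs : Summable A := hsum.of_nonneg_of_le hA0 (fun a => by rw [hGAB]; linarith [hB0 a])
  have hBs : Summable B := hsum.of_nonneg_of_le hB0 (fun a => by rw [hGAB]; linarith [hA0 a])
  let σ : zetaNontrivialZeros ≃ zetaNontrivialZeros :=
    { toFun := fun a => ⟨1 - a, zz_one_sub_mem a.2⟩
      invFun := fun a => ⟨1 - a, zz_one_sub_mem a.2⟩
      left_inv := fun a => by ext; simp
      right_inv := fun a => by ext; simp }
  have hBA : ∀ a, B a = A (σ a) := fun a => by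
    have h1 : ((σ a : zetaNontrivialZeros) : ℂ) = 1 - (a : ℂ) := rfl
    simp only [hA, hB, h1, zz_mult_one_sub a.2]
    simp
  have hBA' : ∑' a, B a = ∑' a, A a := by
    rw [← σ.tsum_eq A]
    exact tsum_congr hBA
  have h2 : ∑' a, A a + ∑' a, B a = L := by
    rw [← hAs.tsum_add hBs, ← htsum]
    exact tsum_congr (fun a => (hGAB a).symm)
  rw [hBA', hL] at h2
  linarith

/-- Assuming the Riemann hypothesis, for every real `t > 0` there is `E` with
`|E| ≤ 7/(4t²)` such that
`Re(ζ'/ζ(1 + i t)) = Σ_γ (1/2)/(1/4 + (t − γ)²) − (1/2) log(t/(2π)) + E`,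
the sum running over the ordinates `γ` of the non-trivial zeros, with multiplicity. -/
theorem re_zeta_logDeriv_eq_sum_over_zeros (RH : RiemannHypothesis) (t : ℝ) (ht : 0 < t) :
    ∃ E : ℝ, |E| ≤ 7 / (4 * t ^ 2) ∧
      (deriv riemannZeta (1 + t * I) / riemannZeta (1 + t * I)).re =
        (∑' ρ : zetaNontrivialZeros,
            (zetaZeroMult ρ : ℝ) * ((1 / 2) / (1 / 4 + (t - (ρ : ℂ).im) ^ 2)))
          - (1 / 2) * Real.log (t / (2 * Real.pi)) + E := by
  have h1 : (1 : ℂ) + t * I ≠ 1 := by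
    intro h
    have := congrArg Complex.im h
    simp at this
    exact ht.ne' this
  have hlog := zz_logDeriv_Xi (s := 1 + t * I) (by simp) h1
  have hdig := zz_digamma_bound (t / 2) (by positivity)
  have harg : ((1 : ℂ) + t * I) / 2 + 1 = 3 / 2 + ((t / 2 : ℝ) : ℂ) * I := by push_cast; ring
  rw [harg] at hlog
  have hre := congrArg Complex.re hlog
  refine ⟨(1 / 2) * (Real.log (t / 2) -
    (logDeriv Gamma (3 / 2 + ((t / 2 : ℝ) : ℂ) * I)).re), ?_, ?_⟩
  · rw [abs_mul, abs_of_pos (by norm_num : (0:ℝ) < 1 / 2)]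
    calc _ ≤ (1 / 2) * (7 / (8 * (t / 2) ^ 2)) := by gcongr
      _ = _ := by field_simp; norm_num
  · have hz0 : (1 / ((1 : ℂ) + t * I - 1)).re = 0 := by
      rw [add_sub_cancel_left]; simp
    have hp : ((1 / 2 : ℂ) * Complex.log Real.pi).re = (1 / 2) * Real.log Real.pi := by
      rw [← Complex.ofReal_log Real.pi_pos.le]
      simp
    have hh : ∀ w : ℂ, ((1 / 2 : ℂ) * w).re = (1 / 2) * w.re := by intro w; simp
    rw [Complex.add_re, Complex.add_re, Complex.sub_re, hz0, hp, hh, ← zz_sum_eq RH t] at hre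
    rw [logDeriv_apply riemannZeta] at hre
    have hl : Real.log (t / (2 * Real.pi)) = Real.log (t / 2) - Real.log Real.pi := by
      rw [← Real.log_div (by positivity) Real.pi_ne_zero]
      congr 1; field_simp
    rw [hl]
    linarith
end

section
/- For Δ > 0 define c_Δ^± = (e^{πΔ/2} ∓ e^{−πΔ/2})² and h_Δ^±(x) = ((1/2)/(1/4 + x²)) · (e^{πΔ} + e^{−πΔ} − 2 cos(2πΔx))/c_Δ^±. Then for every Δ ≥ 1/2 and every real t > 0 there exists a real number E with |E| ≤ 1.3/t² such that (1/2π) ∫_{−∞}^{∞} h_Δ^±(t − u) · Re(Γ'/Γ(1/4 + iu/2)) du = (1/2 + 1/(± e^{πΔ} − 1)) · log(t/2) + E (for each fixed choice of sign, + or −, taken consistently). -/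
open Complex

lemma aux_exp_lt_one {x : ℝ} (hx : x < 0) : Real.exp x < 1 := by
  rw [← Real.exp_zero]
  exact Real.exp_lt_exp.mpr hx

lemma aux_exp_sub (σ : ℝ) (z w : ℂ) (hz : σ ≤ z.re) (hw : σ ≤ w.re) (v : ℝ) (hv : 0 < v) :
    ‖cexp (-w * v) - cexp (-z * v)‖ ≤ ‖w - z‖ * v * Real.exp (-σ * v) := by
  have h := Convex.norm_image_sub_le_of_norm_deriv_le (𝕜 := ℂ) (f := cexp)
    (s := {x : ℂ | x.re ≤ -σ * v}) (C := Real.exp (-σ * v)) (x := -z * v) (y := -w * v)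
    (fun x _ => Complex.differentiableAt_exp)
    (fun x hx => by
      rw [Complex.deriv_exp, Complex.norm_exp]
      exact Real.exp_le_exp.mpr hx)
    (convex_halfSpace_re_le _)
    (by simp; nlinarith) (by simp; nlinarith)
  refine h.trans (le_of_eq ?_)
  have : -w * v - -z * v = -((w - z) * v) := by ring
  rw [this, norm_neg, norm_mul, Complex.norm_real, Real.norm_of_nonneg hv.le]
  ring

lemma aux_div_le (v : ℝ) (hv : 0 < v) : v / (1 - Real.exp (-v)) ≤ 1 + v := by
  have h1 : 0 < 1 - Real.exp (-v) := by
    have := aux_exp_lt_one (x := -v) (by linarith)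
    linarith
  rw [div_le_iff₀ h1]
  have h2 := Real.add_one_le_exp v
  have h3 : Real.exp v * Real.exp (-v) = 1 := by rw [← Real.exp_add]; simp
  have h4 := Real.exp_pos (-v)
  nlinarith

lemma aux_norm_one_sub (v : ℝ) (hv : 0 < v) : ‖(1 : ℂ) - cexp (-v)‖ = 1 - Real.exp (-v) := by
  have h1 : 0 < 1 - Real.exp (-v) := by
    have := aux_exp_lt_one (x := -v) (by linarith)
    linarith
  have : (1 : ℂ) - cexp (-v) = ((1 - Real.exp (-v) : ℝ) : ℂ) := by push_cast; rfl
  rw [this, Complex.norm_real, Real.norm_of_nonneg h1.le]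

lemma aux_dom (σ : ℝ) (z w : ℂ) (hz : σ ≤ z.re) (hw : σ ≤ w.re) (v : ℝ) (hv : 0 < v) :
    ‖(cexp (-w * v) - cexp (-z * v)) / (1 - cexp (-v))‖
      ≤ ‖w - z‖ * ((1 + v) * Real.exp (-σ * v)) := by
  have h1 : 0 < 1 - Real.exp (-v) := by
    have := aux_exp_lt_one (x := -v) (by linarith)
    linarith
  rw [norm_div, aux_norm_one_sub v hv]
  calc _ ≤ (‖w - z‖ * v * Real.exp (-σ * v)) / (1 - Real.exp (-v)) := by
        gcongr
        exact aux_exp_sub σ z w hz hw v hv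
    _ = ‖w - z‖ * ((v / (1 - Real.exp (-v))) * Real.exp (-σ * v)) := by ring
    _ ≤ _ := by
        gcongr
        exact aux_div_le v hv

lemma aux_dom_int (σ : ℝ) (hσ : 0 < σ) :
    MeasureTheory.IntegrableOn (fun v : ℝ => (1 + v) * Real.exp (-σ * v)) (Set.Ioi 0) := by
  have h1 := integrableOn_rpow_mul_exp_neg_mul_rpow (p := 1) (s := 0) (b := σ) (by norm_num) one_pos hσ
  have h2 := integrableOn_rpow_mul_exp_neg_mul_rpow (p := 1) (s := 1) (b := σ) (by norm_num) one_pos hσ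
  refine (h1.add h2).congr_fun (fun v hv => ?_) measurableSet_Ioi
  simp [Real.rpow_one]
  ring

/-- change of variables in the beta integral -/
lemma beta_exp (z : ℂ) (s : ℝ) (hz : 0 < z.re) (hs : 0 < s) :
    MeasureTheory.IntegrableOn
      (fun v : ℝ => cexp (-z * v) * ((1 - Real.exp (-v)) ^ (s - 1) : ℝ)) (Set.Ioi 0) ∧
    betaIntegral z s = ∫ v in Set.Ioi (0:ℝ), cexp (-z * v) * ((1 - Real.exp (-v)) ^ (s - 1) : ℝ) := by
  have himg : (fun v : ℝ => Real.exp (-v)) '' Set.Ioi 0 = Set.Ioo 0 1 := by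
    ext x
    simp only [Set.mem_image, Set.mem_Ioi, Set.mem_Ioo]
    constructor
    · rintro ⟨v, hv, rfl⟩
      exact ⟨Real.exp_pos _, aux_exp_lt_one (by linarith)⟩
    · rintro ⟨h0, h1⟩
      exact ⟨-Real.log x, by have := Real.log_neg h0 h1; linarith, by simp [Real.exp_log h0]⟩
  have hder : ∀ v ∈ Set.Ioi (0:ℝ), HasDerivWithinAt (fun v : ℝ => Real.exp (-v)) (-Real.exp (-v)) (Set.Ioi 0) v := by
    intro v _
    have := ((hasDerivAt_neg v).exp).hasDerivWithinAt (s := Set.Ioi 0)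
    simpa using this
  have hinj : Set.InjOn (fun v : ℝ => Real.exp (-v)) (Set.Ioi 0) := by
    intro a _ b _ h
    simpa using h
  have hconv := betaIntegral_convergent hz (v := (s:ℂ)) (by simpa using hs)
  rw [intervalIntegrable_iff_integrableOn_Ioo_of_le zero_le_one] at hconv
  have key : ∀ v ∈ Set.Ioi (0:ℝ), |-Real.exp (-v)| • (((Real.exp (-v) : ℝ) : ℂ) ^ (z - 1) * (1 - ((Real.exp (-v) : ℝ) : ℂ)) ^ ((s:ℂ) - 1))
      = cexp (-z * v) * ((1 - Real.exp (-v)) ^ (s - 1) : ℝ) := by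
    intro v hv
    have hv' : (0:ℝ) < v := hv
    have h1 : 0 < 1 - Real.exp (-v) := by
      have := aux_exp_lt_one (x := -v) (by linarith)
      linarith
    rw [abs_neg, abs_of_pos (Real.exp_pos _), Complex.real_smul, Complex.ofReal_cpow h1.le]
    rw [Complex.cpow_def_of_ne_zero (by exact_mod_cast (Real.exp_pos _).ne'), ← Complex.ofReal_log (Real.exp_pos _).le, Real.log_exp]
    push_cast
    rw [← mul_assoc, ← Complex.exp_add]
    congr 2
    ring
  constructor
  · rw [← himg, MeasureTheory.integrableOn_image_iff_integrableOn_abs_deriv_smul measurableSet_Ioi hder hinj] at hconv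
    exact hconv.congr_fun key measurableSet_Ioi
  · rw [betaIntegral, intervalIntegral.integral_of_le zero_le_one, MeasureTheory.integral_Ioc_eq_integral_Ioo, ← himg,
      MeasureTheory.integral_image_eq_integral_abs_deriv_smul measurableSet_Ioi hder hinj]
    exact MeasureTheory.setIntegral_congr_fun measurableSet_Ioi key

lemma digamma_sub_integrable (z w : ℂ) (hz : 0 < z.re) (hw : 0 < w.re) :
    MeasureTheory.IntegrableOn (fun v : ℝ => (cexp (-w * v) - cexp (-z * v)) / (1 - cexp (-v))) (Set.Ioi 0) := by
  have hσ : 0 < min z.re w.re := lt_min hz hw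
  refine MeasureTheory.Integrable.mono' ((aux_dom_int _ hσ).const_mul ‖w - z‖) ?_ ?_
  · apply Measurable.aestronglyMeasurable
    fun_prop
  · refine (MeasureTheory.ae_restrict_iff' measurableSet_Ioi).mpr (Filter.Eventually.of_forall fun v hv => ?_)
    exact aux_dom _ z w (min_le_left _ _) (min_le_right _ _) v hv

lemma digamma_sub (z w : ℂ) (hz : 0 < z.re) (hw : 0 < w.re) :
    digamma z - digamma w = ∫ v in Set.Ioi (0:ℝ), (cexp (-w * v) - cexp (-z * v)) / (1 - cexp (-v)) := by
  have hσ : 0 < min z.re w.re := lt_min hz hw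
  set S : ℕ → ℝ := fun n => 1 / ((n:ℝ) + 1) with hS
  have hSpos : ∀ n, 0 < S n := fun n => by simp only [hS]; positivity
  have hS0 : Filter.Tendsto S Filter.atTop (nhds 0) := tendsto_one_div_add_atTop_nhds_zero_nat
  have hlim1 : Filter.Tendsto (fun n => betaIntegral w (S n) - betaIntegral z (S n)) Filter.atTop
      (nhds (∫ v in Set.Ioi (0:ℝ), (cexp (-w * v) - cexp (-z * v)) / (1 - cexp (-v)))) := by
    have heq : ∀ n, betaIntegral w (S n) - betaIntegral z (S n) =
        ∫ v in Set.Ioi (0:ℝ), (cexp (-w * v) - cexp (-z * v)) / (1 - cexp (-v)) * ((1 - Real.exp (-v)) ^ (S n) : ℝ) := by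
      intro n
      obtain ⟨i1, e1⟩ := beta_exp w (S n) hw (hSpos n)
      obtain ⟨i2, e2⟩ := beta_exp z (S n) hz (hSpos n)
      rw [e1, e2, ← MeasureTheory.integral_sub i1 i2]
      refine MeasureTheory.setIntegral_congr_fun measurableSet_Ioi (fun v hv => ?_)
      have hv' : (0:ℝ) < v := hv
      have h1 : 0 < 1 - Real.exp (-v) := by
        have := aux_exp_lt_one (x := -v) (by linarith)
        linarith
      have h2 : (1 : ℂ) - cexp (-v) = ((1 - Real.exp (-v) : ℝ) : ℂ) := by push_cast; rfl
      have h3 : ((1 - Real.exp (-v) : ℝ) : ℂ) ≠ 0 := by exact_mod_cast h1.ne'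
      rw [Real.rpow_sub_one h1.ne', h2, Complex.ofReal_div]
      field_simp
    simp_rw [heq]
    apply MeasureTheory.tendsto_integral_of_dominated_convergence
      (fun v => ‖w - z‖ * ((1 + v) * Real.exp (-(min z.re w.re) * v)))
    · intro n
      apply Measurable.aestronglyMeasurable
      fun_prop
    · exact (aux_dom_int _ hσ).const_mul ‖w - z‖
    · intro n
      refine (MeasureTheory.ae_restrict_iff' measurableSet_Ioi).mpr (Filter.Eventually.of_forall fun v hv => ?_)
      have hv' : (0:ℝ) < v := hv
      have h1 : 0 < 1 - Real.exp (-v) := by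
        have := aux_exp_lt_one (x := -v) (by linarith)
        linarith
      rw [norm_mul, Complex.norm_real, Real.norm_of_nonneg (Real.rpow_nonneg h1.le _)]
      refine (mul_le_of_le_one_right (norm_nonneg _) (Real.rpow_le_one h1.le ?_ (hSpos n).le)).trans
        (aux_dom _ z w (min_le_left _ _) (min_le_right _ _) v hv)
      linarith [Real.exp_pos (-v)]
    · refine (MeasureTheory.ae_restrict_iff' measurableSet_Ioi).mpr (Filter.Eventually.of_forall fun v hv => ?_)
      have hv' : (0:ℝ) < v := hv
      have h1 : 0 < 1 - Real.exp (-v) := by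
        have := aux_exp_lt_one (x := -v) (by linarith)
        linarith
      have hc : Filter.Tendsto (fun n => (1 - Real.exp (-v)) ^ (S n)) Filter.atTop (nhds 1) := by
        have := (Real.continuousAt_const_rpow (a := 1 - Real.exp (-v)) (b := 0) h1.ne').tendsto.comp hS0
        simpa [Function.comp_def] using this
      have hc2 : Filter.Tendsto (fun n => (((1 - Real.exp (-v)) ^ (S n) : ℝ) : ℂ)) Filter.atTop (nhds ((1:ℝ):ℂ)) :=
        (Complex.continuous_ofReal.tendsto 1).comp hc
      have := hc2.const_mul ((cexp (-w * v) - cexp (-z * v)) / (1 - cexp (-v)))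
      simpa using this
  have hne : ∀ x : ℂ, 0 < x.re → ∀ m : ℕ, x ≠ -m := by
    intro x hx m h
    rw [h] at hx
    simp at hx
    have : (0:ℝ) ≤ m := Nat.cast_nonneg m
    linarith
  have hlim2 : Filter.Tendsto (fun n => betaIntegral w (S n) - betaIntegral z (S n)) Filter.atTop
      (nhds (digamma z - digamma w)) := by
    have hd : ∀ x : ℂ, 0 < x.re → HasDerivAt (fun s : ℂ => Gamma x / Gamma (x + s)) (- digamma x) 0 := by
      intro x hx
      have h1 : HasDerivAt Gamma (deriv Gamma x) (x + 0) := by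
        rw [add_zero]; exact (differentiableAt_Gamma x (hne x hx)).hasDerivAt
      have h2 := (h1.comp_const_add x 0)
      have hg := Gamma_ne_zero_of_re_pos hx
      have h3 := (hasDerivAt_const (0:ℂ) (Gamma x)).div h2 (by simpa using hg)
      have h8 : (0 * Gamma (x + 0) - Gamma x * deriv Gamma x) / Gamma (x + 0) ^ 2 = - digamma x := by
        rw [digamma_def, logDeriv_apply, add_zero]
        field_simp
        ring
      rw [h8] at h3
      exact h3
    have hd2 := (hd w hw).sub (hd z hz)
    have hsl := hd2.tendsto_slope
    have hSc : Filter.Tendsto (fun n => (S n : ℂ)) Filter.atTop (nhdsWithin 0 {0}ᶜ) := by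
      refine tendsto_nhdsWithin_iff.mpr ⟨?_, Filter.Eventually.of_forall fun n => ?_⟩
      · simpa [Function.comp_def] using (Complex.continuous_ofReal.tendsto 0).comp hS0
      · simpa using (hSpos n).ne'
    have h4 := hsl.comp hSc
    have h5 : Filter.Tendsto (fun n => Gamma ((S n : ℂ) + 1)) Filter.atTop (nhds 1) := by
      have hc : ContinuousAt Gamma 1 := (differentiableAt_Gamma 1 (hne 1 (by simp))).continuousAt
      have h6 : Filter.Tendsto (fun n => ((S n : ℂ) + 1)) Filter.atTop (nhds 1) := by
        have := ((Complex.continuous_ofReal.tendsto 0).comp hS0).add_const (1:ℂ)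
        simpa using this
      have := hc.tendsto.comp h6
      simpa [Function.comp_def] using this
    have h7 := h5.mul h4
    rw [one_mul, neg_sub_neg] at h7
    refine h7.congr (fun n => ?_)
    have hs0 : (S n : ℂ) ≠ 0 := by exact_mod_cast (hSpos n).ne'
    have hsr : 0 < (S n : ℂ).re := by simpa using hSpos n
    rw [betaIntegral_eq_Gamma_mul_div _ _ hw hsr, betaIntegral_eq_Gamma_mul_div _ _ hz hsr]
    have hgw := Gamma_ne_zero_of_re_pos hw
    have hgz := Gamma_ne_zero_of_re_pos hz
    simp only [Function.comp, slope_def_field, Pi.sub_apply, add_zero, div_self hgw, div_self hgz, sub_self, sub_zero]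
    rw [Gamma_add_one _ hs0]
    field_simp
  exact tendsto_nhds_unique hlim2 hlim1


lemma digamma_nat_lim (y : ℝ) :
    Filter.Tendsto (fun n : ℕ => (digamma ((n : ℂ) + 1/2 + I * y)).re - (digamma ((n : ℂ) + 1)).re)
      Filter.atTop (nhds 0) := by
  have h0 : Filter.Tendsto (fun n : ℕ => digamma ((n : ℂ) + 1/2 + I * y) - digamma ((n : ℂ) + 1))
      Filter.atTop (nhds 0) := by
    have hz : ∀ n : ℕ, ((n : ℂ) + 1/2 + I * y).re = n + 1/2 := fun n => by simp
    have hw : ∀ n : ℕ, ((n : ℂ) + 1).re = n + 1 := fun n => by simp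
    have heq : ∀ n : ℕ, digamma ((n : ℂ) + 1/2 + I * y) - digamma ((n : ℂ) + 1) = _ := fun n =>
      digamma_sub ((n : ℂ) + 1/2 + I * y) ((n : ℂ) + 1) (by rw [hz]; positivity) (by rw [hw]; positivity)
    simp_rw [heq]
    set C : ℝ := ‖(1/2 : ℂ) - I * y‖ with hC
    have hd : ∀ n : ℕ, ‖(n : ℂ) + 1 - ((n : ℂ) + 1/2 + I * y)‖ = C := fun n => by
      rw [hC]; congr 1; ring
    have hb : ∀ (n : ℕ) (v : ℝ), 0 < v → ‖(cexp (-((n : ℂ) + 1) * v) - cexp (-((n : ℂ) + 1/2 + I * y) * v)) / (1 - cexp (-v))‖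
        ≤ C * ((1 + v) * Real.exp (-((n:ℝ) + 1/2) * v)) := by
      intro n v hv
      have := aux_dom ((n:ℝ) + 1/2) ((n : ℂ) + 1/2 + I * y) ((n : ℂ) + 1) (hz n).ge (by rw [hw]; linarith) v hv
      rwa [hd] at this
    have : (0 : ℂ) = ∫ v in Set.Ioi (0:ℝ), (0:ℂ) := by simp
    rw [this]
    apply MeasureTheory.tendsto_integral_of_dominated_convergence
      (fun v => C * ((1 + v) * Real.exp (-(1/2) * v)))
    · intro n
      apply Measurable.aestronglyMeasurable
      fun_prop
    · exact (aux_dom_int (1/2) (by norm_num)).const_mul _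
    · intro n
      refine (MeasureTheory.ae_restrict_iff' measurableSet_Ioi).mpr (Filter.Eventually.of_forall fun v hv => ?_)
      have hv' : (0:ℝ) < v := hv
      refine (hb n v hv).trans ?_
      have hn : (0:ℝ) ≤ n := Nat.cast_nonneg n
      have : Real.exp (-((n:ℝ) + 1/2) * v) ≤ Real.exp (-(1/2) * v) := Real.exp_le_exp.mpr (by nlinarith)
      gcongr
    · refine (MeasureTheory.ae_restrict_iff' measurableSet_Ioi).mpr (Filter.Eventually.of_forall fun v hv => ?_)
      have hv' : (0:ℝ) < v := hv
      refine squeeze_zero_norm (fun n => hb n v hv) ?_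
      have h1 : Filter.Tendsto (fun n : ℕ => Real.exp (-((n:ℝ) + 1/2) * v)) Filter.atTop (nhds 0) := by
        apply Real.tendsto_exp_atBot.comp
        have : Filter.Tendsto (fun n : ℕ => ((n:ℝ) + 1/2) * v) Filter.atTop Filter.atTop :=
          (Filter.tendsto_atTop_add_const_right _ _ tendsto_natCast_atTop_atTop).atTop_mul_const hv'
        have h2 := Filter.tendsto_neg_atTop_atBot.comp this
        refine h2.congr (fun n => ?_)
        simp only [Function.comp]
        ring
      have := (h1.const_mul (1 + v)).const_mul C
      simpa using this
  have := (Complex.continuous_re.tendsto 0).comp h0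
  simpa [Function.comp_def] using this

lemma digamma_nat_val (n : ℕ) : (digamma ((n:ℂ) + 1)).re = -Real.eulerMascheroniConstant + harmonic n := by
  rw [digamma_def, logDeriv_apply, deriv_Gamma_nat, Gamma_nat_eq_factorial]
  have : ((n.factorial : ℕ) : ℂ) ≠ 0 := by exact_mod_cast n.factorial_ne_zero
  rw [mul_div_cancel_left₀ _ this]
  simp

lemma D_lim (y : ℝ) :
    Filter.Tendsto (fun n : ℕ => (digamma ((n : ℂ) + 1/2 + I * y)).re - 1/2 * Real.log ((n:ℝ)^2 + y^2))
      Filter.atTop (nhds 0) := by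
  have h1 := digamma_nat_lim y
  simp_rw [digamma_nat_val] at h1
  have h2 := Real.tendsto_harmonic_sub_log
  have h3 : Filter.Tendsto (fun n : ℕ => 1/2 * Real.log (1 + (y / n)^2)) Filter.atTop (nhds 0) := by
    have a1 : Filter.Tendsto (fun n : ℕ => y / (n:ℝ)) Filter.atTop (nhds 0) := tendsto_const_div_atTop_nhds_zero_nat y
    have a2 : Filter.Tendsto (fun n : ℕ => 1 + (y / (n:ℝ))^2) Filter.atTop (nhds 1) := by
      have := (a1.pow 2).const_add 1
      simpa using this
    have a3 := ((Real.continuousAt_log (x := 1) one_ne_zero).tendsto.comp a2).const_mul (1/2)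
    simpa [Function.comp_def] using a3
  have h4 := ((h1.add h2).sub h3).sub_const Real.eulerMascheroniConstant
  simp only [zero_add, sub_zero, sub_self] at h4
  refine h4.congr' ?_
  filter_upwards [Filter.eventually_gt_atTop 0] with n hn
  have hn' : (0:ℝ) < n := by exact_mod_cast hn
  have : (n:ℝ)^2 + y^2 = n^2 * (1 + (y/n)^2) := by field_simp
  rw [this, Real.log_mul (by positivity) (by positivity), Real.log_pow]
  push_cast
  ring

/-- midpoint rule -/
lemma midpoint_aux (y : ℝ) (hy : 0 < y) (m : ℝ) :
    |1/2 * Real.log ((m + 1/2)^2 + y^2) - 1/2 * Real.log ((m - 1/2)^2 + y^2) - m / (m^2 + y^2)|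
      ≤ 1/4 * ((m+1/2) / (y^2 * √((m+1/2)^2 + y^2)) - (m-1/2) / (y^2 * √((m-1/2)^2 + y^2))) := by
  set A : ℝ → ℝ := fun x => x / (y^2 * √(x^2 + y^2)) with hA
  set φ : ℝ → ℝ := fun x => x / (x^2 + y^2) with hφ
  set φ' : ℝ → ℝ := fun x => (y^2 - x^2) / (x^2 + y^2)^2 with hφ'
  set Φ : ℝ → ℝ := fun x => 1/2 * Real.log (x^2 + y^2) with hΦ
  have hp : ∀ x : ℝ, 0 < x^2 + y^2 := fun x => by positivity
  have dq : ∀ x : ℝ, HasDerivAt (fun x : ℝ => x^2 + y^2) (2 * x) x := fun x => by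
    simpa using (hasDerivAt_pow 2 x).add_const (y^2)
  have dΦ : ∀ x, HasDerivAt Φ (φ x) x := fun x => by
    have := ((dq x).log (hp x).ne').const_mul (1/2)
    refine HasDerivAt.congr_deriv this ?_
    simp only [hφ]
    ring
  have dφ : ∀ x, HasDerivAt φ (φ' x) x := fun x => by
    have := (hasDerivAt_id x).div (dq x) (hp x).ne'
    refine HasDerivAt.congr_deriv this ?_
    simp only [hφ', id]
    ring
  have dφ' : ∀ x, HasDerivAt φ' (2 * x * (x^2 - 3 * y^2) / (x^2 + y^2)^3) x := fun x => by
    have h1 : HasDerivAt (fun x : ℝ => y^2 - x^2) (-(2 * x)) x := by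
      simpa using (hasDerivAt_pow 2 x).const_sub (y^2)
    have := h1.div ((dq x).pow 2) (pow_pos (hp x) 2).ne'
    refine HasDerivAt.congr_deriv this ?_
    have := (hp x).ne'
    simp only [Pi.pow_apply]
    field_simp
    push_cast
    ring
  have dA : ∀ x, HasDerivAt A (1 / (√(x^2 + y^2))^3) x := fun x => by
    have hs := Real.sqrt_pos.mpr (hp x)
    have h1 := ((dq x).sqrt (hp x).ne').const_mul (y^2)
    have := (hasDerivAt_id x).div h1 (by positivity)
    refine HasDerivAt.congr_deriv this ?_
    simp only [id]
    have hsq := Real.sq_sqrt (hp x).le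
    set r := √(x^2 + y^2)
    field_simp
    rw [hsq]
    ring
  have hbd : ∀ x : ℝ, |2 * x * (x^2 - 3 * y^2) / (x^2 + y^2)^3| ≤ 2 * (1 / (√(x^2 + y^2))^3) := fun x => by
    have hs := Real.sqrt_pos.mpr (hp x)
    have hsq := Real.sq_sqrt (hp x).le
    set r := √(x^2 + y^2)
    rw [← hsq]
    have hk : |x * (x^2 - 3 * y^2)| ≤ r^3 := by
      apply abs_le_of_sq_le_sq _ (by positivity)
      have : (r^3)^2 = (x^2+y^2)^3 := by rw [← hsq]; ring
      rw [this]
      nlinarith [sq_nonneg (y * (3 * x^2 - y^2))]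
    rw [mul_assoc, abs_div, abs_mul, abs_of_pos (show (0:ℝ) < 2 by norm_num), abs_of_pos (show 0 < (r^2)^3 by positivity)]
    rw [div_le_iff₀ (by positivity)]
    have : 2 * (1 / r^3) * (r^2)^3 = 2 * r^3 := by field_simp
    rw [this]
    linarith
  have mono1 : Monotone (fun x => 2 * A x - φ' x) := by
    apply monotone_of_hasDerivAt_nonneg (f' := fun x => 2 * (1 / (√(x^2 + y^2))^3) - 2 * x * (x^2 - 3 * y^2) / (x^2 + y^2)^3)
    · intro x; exact ((dA x).const_mul 2).sub (dφ' x)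
    · intro x; have := (abs_le.mp (hbd x)).2; simp only [Pi.zero_apply]; linarith
  have mono2 : Monotone (fun x => 2 * A x + φ' x) := by
    apply monotone_of_hasDerivAt_nonneg (f' := fun x => 2 * (1 / (√(x^2 + y^2))^3) + 2 * x * (x^2 - 3 * y^2) / (x^2 + y^2)^3)
    · intro x; exact ((dA x).const_mul 2).add (dφ' x)
    · intro x; have := (abs_le.mp (hbd x)).1; simp only [Pi.zero_apply]; linarith
  have monoA : Monotone A := by
    apply monotone_of_hasDerivAt_nonneg (f' := fun x => (1 / (√(x^2 + y^2))^3)) dA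
    intro x; simp only [Pi.zero_apply]; positivity
  set δ := A (m + 1/2) - A (m - 1/2) with hδ
  -- second derivative bound
  have hM2 : ∀ s : ℝ, 0 ≤ s → s ≤ 1/2 → |φ' (m + s) - φ' (m - s)| ≤ 2 * δ := by
    intro s h0 h1
    have a1 := mono1 (show m - s ≤ m + s by linarith)
    have a2 := mono2 (show m - s ≤ m + s by linarith)
    have a3 := monoA (show m + s ≤ m + 1/2 by linarith)
    have a4 := monoA (show m - 1/2 ≤ m - s by linarith)
    simp only at a1 a2
    rw [abs_le]
    constructor <;> linarith
  have dplus : ∀ s : ℝ, HasDerivAt (fun s : ℝ => m + s) 1 s := fun s => (hasDerivAt_id s).const_add m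
  have dminus : ∀ s : ℝ, HasDerivAt (fun s : ℝ => m - s) (-1) s := fun s => (hasDerivAt_id s).const_sub m
  set N : ℝ → ℝ := fun s => φ (m + s) + φ (m - s) - 2 * φ m with hN
  set M : ℝ → ℝ := fun s => Φ (m + s) - Φ (m - s) - 2 * s * φ m with hM
  have dN : ∀ s, HasDerivAt N (φ' (m + s) - φ' (m - s)) s := fun s => by
    have h1 := (dφ (m + s)).comp s (dplus s)
    have h2 := (dφ (m - s)).comp s (dminus s)
    have := (h1.add h2).sub_const (2 * φ m)
    refine HasDerivAt.congr_deriv this ?_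
    ring
  have dM : ∀ s, HasDerivAt M (N s) s := fun s => by
    have h1 := (dΦ (m + s)).comp s (dplus s)
    have h2 := (dΦ (m - s)).comp s (dminus s)
    have h3 := ((hasDerivAt_id s).const_mul 2).mul_const (φ m)
    have := (h1.sub h2).sub h3
    refine HasDerivAt.congr_deriv this ?_
    simp only [hN]
    ring
  have hNb : ∀ s ∈ Set.Icc (0:ℝ) (1/2), ‖N s‖ ≤ 2 * δ * s := by
    refine image_norm_le_of_norm_deriv_right_le_deriv_boundary (f' := fun s => φ' (m + s) - φ' (m - s)) (B' := fun _ => 2 * δ)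
      (fun s _ => (dN s).continuousAt.continuousWithinAt) (fun s _ => (dN s).hasDerivWithinAt) ?_ (fun s => ?_) ?_
    · simp [hN]; linarith
    · simpa using (hasDerivAt_id s).const_mul (2 * δ)
    · intro s hs
      exact hM2 s hs.1 hs.2.le
  have hMb : ∀ s ∈ Set.Icc (0:ℝ) (1/2), ‖M s‖ ≤ δ * s^2 := by
    refine image_norm_le_of_norm_deriv_right_le_deriv_boundary (f' := N) (B' := fun s => 2 * δ * s)
      (fun s _ => (dM s).continuousAt.continuousWithinAt) (fun s _ => (dM s).hasDerivWithinAt) ?_ (fun s => ?_) ?_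
    · simp [hM]
    · refine HasDerivAt.congr_deriv ((hasDerivAt_pow 2 s).const_mul δ) ?_
      push_cast; ring
    · intro s hs
      exact hNb s ⟨hs.1, hs.2.le⟩
  have := hMb (1/2) ⟨by norm_num, le_rfl⟩
  rw [Real.norm_eq_abs] at this
  simp only [hM, hΦ, hφ] at this
  calc _ = |1 / 2 * Real.log ((m + 1 / 2) ^ 2 + y ^ 2) - 1 / 2 * Real.log ((m - 1 / 2) ^ 2 + y ^ 2) -
      2 * (1 / 2) * (m / (m ^ 2 + y ^ 2))| := by congr 1; ring
    _ ≤ _ := this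
    _ = _ := by simp only [hδ, hA]; ring

lemma digamma_log_bound (y : ℝ) (hy : 0 < y) :
    |(digamma (1/2 + I * y)).re - Real.log y| ≤ 1 / (4 * y^2) := by
  set D : ℕ → ℝ := fun n => (digamma ((n : ℂ) + 1/2 + I * y)).re - 1/2 * Real.log ((n:ℝ)^2 + y^2) with hD
  set A : ℝ → ℝ := fun x => x / (y^2 * √(x^2 + y^2)) with hA
  have hstep : ∀ n : ℕ, |D (n+1) - D n| ≤ 1/4 * (A ((n+1 : ℕ):ℝ) - A n) := by
    intro n
    have h1 : digamma (((n+1 : ℕ) : ℂ) + 1/2 + I * y) = digamma ((n : ℂ) + 1/2 + I * y) + ((n : ℂ) + 1/2 + I * y)⁻¹ := by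
      rw [← digamma_apply_add_one]
      · congr 1; push_cast; ring
      · intro k h
        have := congrArg Complex.re h
        simp at this
        have h1 : (0:ℝ) ≤ n := Nat.cast_nonneg n
        have h2 : (0:ℝ) ≤ k := Nat.cast_nonneg k
        linarith
    have h2 : (((n : ℂ) + 1/2 + I * y)⁻¹).re = ((n:ℝ) + 1/2) / (((n:ℝ) + 1/2)^2 + y^2) := by
      rw [Complex.inv_re, Complex.normSq_apply]
      simp
      ring
    have h3 := midpoint_aux y hy ((n:ℝ) + 1/2)
    rw [show (n:ℝ) + 1/2 + 1/2 = ((n+1 : ℕ) : ℝ) by push_cast; ring, show (n:ℝ) + 1/2 - 1/2 = n by ring] at h3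
    rw [abs_sub_comm]
    convert h3 using 2
    simp only [hD]
    rw [h1, Complex.add_re, h2]
    ring
  have hA0 : A 0 = 0 := by simp [hA]
  have hsum : ∀ n : ℕ, |D n - D 0| ≤ 1/4 * A n := by
    intro n
    induction n with
    | zero => simp [hA0]
    | succ k ih =>
      have := abs_sub_le (D (k+1)) (D k) (D 0)
      have := hstep k
      linarith
  have hAle : ∀ n : ℕ, A n ≤ 1 / y^2 := by
    intro n
    simp only [hA]
    have hs : (n:ℝ) ≤ √((n:ℝ)^2 + y^2) := Real.le_sqrt_of_sq_le (by nlinarith [sq_nonneg y])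
    have hpos : 0 < √((n:ℝ)^2 + y^2) := Real.sqrt_pos.mpr (by positivity)
    rw [div_le_div_iff₀ (by positivity) (by positivity)]
    nlinarith [mul_le_mul_of_nonneg_left hs (sq_nonneg y)]
  have hlim : Filter.Tendsto (fun n => |D n - D 0|) Filter.atTop (nhds |0 - D 0|) :=
    ((D_lim y).sub_const (D 0)).abs
  have hfin : |0 - D 0| ≤ 1/4 * (1 / y^2) := by
    refine le_of_tendsto hlim (Filter.Eventually.of_forall fun n => (hsum n).trans ?_)
    have := hAle n
    linarith
  have hD0 : D 0 = (digamma (1/2 + I * y)).re - Real.log y := by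
    simp [hD]
  rw [← hD0]
  rw [zero_sub, abs_neg] at hfin
  refine hfin.trans (le_of_eq ?_)
  field_simp


noncomputable def PK (x : ℝ) : ℝ := (1 / 2) / (1 / 4 + x ^ 2)

lemma PK_pos (x : ℝ) : 0 < PK x := by unfold PK; positivity

lemma PK_cont : Continuous PK := by
  unfold PK
  refine Continuous.div (by fun_prop) (by fun_prop) (fun x => by positivity)

lemma PK_le (x : ℝ) : PK x ≤ 2 * (1 + x^2)⁻¹ := by
  unfold PK
  rw [← div_eq_mul_inv, div_le_div_iff₀ (by positivity) (by positivity)]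
  nlinarith [sq_nonneg x]

lemma PK_int : MeasureTheory.Integrable PK := by
  refine MeasureTheory.Integrable.mono' (integrable_inv_one_add_sq.const_mul 2) PK_cont.aestronglyMeasurable
    (Filter.Eventually.of_forall fun x => ?_)
  rw [Real.norm_of_nonneg (PK_pos x).le]
  exact PK_le x

open FourierTransform in
lemma PK_fourier (ξ : ℝ) : ∫ x : ℝ, cexp ((ξ * x : ℝ) * I) * (PK x : ℂ) = (Real.pi * Real.exp (-|ξ| / 2) : ℝ) := by
  set f : ℝ → ℂ := fun x => (Real.exp (-Real.pi * |x|) : ℂ) with hf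
  have hpi := Real.pi_pos
  have fcont : Continuous f := by fun_prop
  have e1 : ∀ w : ℝ, Set.EqOn (fun x : ℝ => cexp (((-Real.pi : ℂ) - 2 * Real.pi * w * I) * x))
      (fun v : ℝ => cexp (↑(-2 * Real.pi * v * w) * I) • f v) (Set.Ioi 0) := by
    intro w x hx
    have hx' : (0:ℝ) < x := hx
    simp only [hf, abs_of_pos hx', smul_eq_mul]
    push_cast
    rw [← Complex.exp_add]
    congr 1; ring
  have e2 : ∀ w : ℝ, Set.EqOn (fun x : ℝ => cexp (((Real.pi : ℂ) - 2 * Real.pi * w * I) * x))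
      (fun v : ℝ => cexp (↑(-2 * Real.pi * v * w) * I) • f v) (Set.Iic 0) := by
    intro w x hx
    have hx' : x ≤ 0 := hx
    simp only [hf, abs_of_nonpos hx', smul_eq_mul]
    push_cast
    rw [← Complex.exp_add]
    congr 1; ring
  have r1 : ∀ w : ℝ, ((-Real.pi : ℂ) - 2 * Real.pi * w * I).re < 0 := by intro w; simp [hpi]
  have r2 : ∀ w : ℝ, 0 < ((Real.pi : ℂ) - 2 * Real.pi * w * I).re := by intro w; simp [hpi]
  have i1 : ∀ w : ℝ, MeasureTheory.IntegrableOn (fun v : ℝ => cexp (↑(-2 * Real.pi * v * w) * I) • f v) (Set.Ioi 0) :=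
    fun w => (integrableOn_exp_mul_complex_Ioi (r1 w) 0).congr_fun (e1 w) measurableSet_Ioi
  have i2 : ∀ w : ℝ, MeasureTheory.IntegrableOn (fun v : ℝ => cexp (↑(-2 * Real.pi * v * w) * I) • f v) (Set.Iic 0) :=
    fun w => (integrableOn_exp_mul_complex_Iic (r2 w) 0).congr_fun (e2 w) measurableSet_Iic
  have fint : MeasureTheory.Integrable f := by
    have := (i2 0).union (i1 0)
    rw [Set.Iic_union_Ioi, MeasureTheory.integrableOn_univ] at this
    simpa using this
  have hF : 𝓕 f = fun w : ℝ => ((1 / Real.pi : ℝ) : ℂ) * (PK w : ℂ) := by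
    ext w
    rw [Real.fourier_real_eq_integral_exp_smul, ← intervalIntegral.integral_Iic_add_Ioi (i2 w) (i1 w),
      ← MeasureTheory.setIntegral_congr_fun measurableSet_Ioi (e1 w),
      ← MeasureTheory.setIntegral_congr_fun measurableSet_Iic (e2 w),
      integral_exp_mul_complex_Ioi (r1 w), integral_exp_mul_complex_Iic (r2 w)]
    have n1 : (-Real.pi : ℂ) - 2 * Real.pi * w * I ≠ 0 := fun h => by
      have := r1 w; rw [h] at this; simp at this
    have n2 : (Real.pi : ℂ) - 2 * Real.pi * w * I ≠ 0 := fun h => by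
      have := r2 w; rw [h] at this; simp at this
    have n3 : (Real.pi : ℂ) ≠ 0 := by exact_mod_cast hpi.ne'
    have n4 : (1 / 4 : ℂ) + w^2 ≠ 0 := by
      have : (1/4 + w^2 : ℝ) ≠ 0 := by positivity
      have h := Complex.ofReal_ne_zero.mpr this
      push_cast at h
      exact h
    unfold PK
    push_cast
    simp only [mul_zero, Complex.exp_zero]
    rw [div_add_div _ _ n2 n1, one_div_mul_eq_div, div_div, div_eq_div_iff (mul_ne_zero n2 n1) (mul_ne_zero n4 n3)]
    ring_nf
    simp only [I_sq]
    ring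
  have hFint : MeasureTheory.Integrable (𝓕 f) := by
    rw [hF]
    exact (PK_int.ofReal).const_mul _
  have hinv := fint.fourierInv_fourier_eq hFint (v := ξ / (2 * Real.pi)) fcont.continuousAt
  rw [hF, Real.fourierInv_eq'] at hinv
  have n3 : (Real.pi : ℂ) ≠ 0 := by exact_mod_cast hpi.ne'
  have : ∫ x : ℝ, cexp ((ξ * x : ℝ) * I) * (PK x : ℂ) = Real.pi * ∫ (v : ℝ), cexp (↑(2 * Real.pi * inner ℝ v (ξ / (2 * Real.pi))) * I) • (((1 / Real.pi : ℝ) : ℂ) * ↑(PK v)) := by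
    rw [← MeasureTheory.integral_const_mul]
    congr 1
    ext x
    have : 2 * Real.pi * inner ℝ x (ξ / (2 * Real.pi)) = ξ * x := by
      simp
      field_simp
    rw [this, smul_eq_mul]
    push_cast
    field_simp
  rw [this, hinv]
  simp only [hf]
  push_cast
  congr 2
  rw [abs_div, abs_of_pos (show 0 < 2 * Real.pi by positivity)]
  push_cast
  field_simp

lemma PK_cos_int (ξ β : ℝ) : MeasureTheory.Integrable (fun x => PK x * Real.cos (ξ * x + β)) := by
  refine PK_int.mono (PK_cont.mul (by fun_prop)).aestronglyMeasurable (Filter.Eventually.of_forall fun x => ?_)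
  rw [norm_mul]
  exact mul_le_of_le_one_right (norm_nonneg _) (Real.abs_cos_le_one _)

lemma PK_cos (ξ β : ℝ) : ∫ x : ℝ, PK x * Real.cos (ξ * x + β) = Real.pi * Real.exp (-|ξ| / 2) * Real.cos β := by
  have h := PK_fourier ξ
  have h2 : ∫ x : ℝ, cexp (β * I) * (cexp ((ξ * x : ℝ) * I) * (PK x : ℂ)) = cexp (β * I) * (Real.pi * Real.exp (-|ξ| / 2) : ℝ) := by
    rw [MeasureTheory.integral_const_mul, h]
  have hintg : MeasureTheory.Integrable (fun x : ℝ => cexp (β * I) * (cexp ((ξ * x : ℝ) * I) * (PK x : ℂ))) := by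
    apply MeasureTheory.Integrable.const_mul
    refine (PK_int.ofReal (𝕜 := ℂ)).mono ((Continuous.mul (by fun_prop) (continuous_ofReal.comp PK_cont)).aestronglyMeasurable)
      (Filter.Eventually.of_forall fun x => ?_)
    rw [norm_mul, Complex.norm_exp_ofReal_mul_I, one_mul]
    exact le_rfl
  have h3 := congrArg Complex.re h2
  have h4 : ∀ x : ℝ, (cexp (β * I) * (cexp ((ξ * x : ℝ) * I) * (PK x : ℂ))).re = PK x * Real.cos (ξ * x + β) := by
    intro x
    rw [← mul_assoc, ← Complex.exp_add, Complex.re_mul_ofReal, ← add_mul, ← Complex.ofReal_add, Complex.exp_ofReal_mul_I_re]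
    rw [mul_comm, add_comm]
  have h5 := integral_re hintg
  simp only [RCLike.re_to_complex] at h5
  rw [← h5] at h3
  simp_rw [h4] at h3
  rw [h3, Complex.re_mul_ofReal, Complex.exp_ofReal_mul_I_re]
  ring

/-- the extremal function with parameters -/
noncomputable def HK (θ c x : ℝ) : ℝ := PK x * ((Real.exp (θ / 2) + Real.exp (-(θ / 2)) - 2 * Real.cos (θ * x)) / c)

lemma HK_cont (θ c : ℝ) : Continuous (HK θ c) := by
  unfold HK
  exact PK_cont.mul (by fun_prop)

lemma HK_conv (θ c t x : ℝ) (hθ : 0 < θ) (hx : 0 ≤ x) :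
    ∫ u : ℝ, HK θ c (t - u) * Real.cos (u * x) =
      Real.cos (t * x) * (Real.pi * (max (Real.exp (θ / 2) * Real.exp (-x/2) - Real.exp (-(θ / 2)) * Real.exp (x/2)) 0 / c)) := by
  have h1 : ∫ u : ℝ, HK θ c (t - u) * Real.cos (u * x) = ∫ s : ℝ, HK θ c s * Real.cos ((t - s) * x) := by
    rw [← MeasureTheory.integral_sub_left_eq_self _ MeasureTheory.volume t]
    simp
  rw [h1]
  have h2 : ∀ s : ℝ, HK θ c s * Real.cos ((t - s) * x) =
      (Real.exp (θ / 2) + Real.exp (-(θ / 2))) / c * (PK s * Real.cos ((-x) * s + t * x))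
      - 1 / c * (PK s * Real.cos ((θ - x) * s + t * x)) - 1 / c * (PK s * Real.cos ((-(θ + x)) * s + t * x)) := by
    intro s
    have e1 : (θ - x) * s + t * x = (t - s) * x + θ * s := by ring
    have e2 : (-(θ + x)) * s + t * x = (t - s) * x - θ * s := by ring
    have e3 : (-x) * s + t * x = (t - s) * x := by ring
    rw [e1, e2, e3, Real.cos_add, Real.cos_sub]
    unfold HK
    ring
  simp_rw [h2]
  rw [MeasureTheory.integral_sub, MeasureTheory.integral_sub, MeasureTheory.integral_const_mul,
    MeasureTheory.integral_const_mul, MeasureTheory.integral_const_mul, PK_cos, PK_cos, PK_cos]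
  rotate_left
  · exact (PK_cos_int _ _).const_mul _
  · exact (PK_cos_int _ _).const_mul _
  · exact ((PK_cos_int _ _).const_mul _).sub ((PK_cos_int _ _).const_mul _)
  · exact (PK_cos_int _ _).const_mul _
  rw [abs_neg, abs_neg, abs_of_nonneg hx, abs_of_pos (show 0 < θ + x by linarith)]
  have e4 : Real.exp (-(θ + x) / 2) = Real.exp (-(θ / 2)) * Real.exp (-x / 2) := by
    rw [← Real.exp_add]; congr 1; ring
  have e5 : Real.exp (θ / 2) * Real.exp (-x / 2) = Real.exp ((θ - x)/2) := by
    rw [← Real.exp_add]; congr 1; ring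
  have e6 : Real.exp (-(θ / 2)) * Real.exp (x / 2) = Real.exp (-((θ - x)/2)) := by
    rw [← Real.exp_add]; congr 1; ring
  rw [e4]
  rcases le_total x θ with h | h
  · rw [abs_of_nonneg (by linarith), max_eq_left]
    · rw [show -(θ - x)/2 = -((θ - x)/2) by ring, ← e6]
      ring
    · rw [e5, e6]
      have : Real.exp (-((θ - x)/2)) ≤ Real.exp ((θ - x)/2) := Real.exp_le_exp.mpr (by linarith)
      linarith
  · rw [abs_of_nonpos (by linarith), max_eq_right]
    · rw [show - -(θ - x)/2 = ((θ - x)/2) by ring, ← e5]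
      ring
    · rw [e5, e6]
      have : Real.exp ((θ - x)/2) ≤ Real.exp (-((θ - x)/2)) := Real.exp_le_exp.mpr (by linarith)
      linarith


noncomputable def GK (t u x : ℝ) : ℝ := (Real.cos (t * x) - Real.exp (x / 2) * Real.cos (u * x)) / Real.sinh x

lemma digamma_re_sub (t u : ℝ) :
    (digamma (1/4 + I * u / 2)).re - (digamma (1/2 + I * t / 2)).re = ∫ x in Set.Ioi (0:ℝ), GK t u x := by
  have hz : 0 < (1/4 + I * u / 2 : ℂ).re := by
    have : (1/4 + I * u / 2 : ℂ) = ((1/4 : ℝ) : ℂ) + (u / 2 : ℝ) * I := by push_cast; ring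
    rw [this]; simp
  have hw : 0 < (1/2 + I * t / 2 : ℂ).re := by
    have : (1/2 + I * t / 2 : ℂ) = ((1/2 : ℝ) : ℂ) + (t / 2 : ℝ) * I := by push_cast; ring
    rw [this]; simp
  have h1 := digamma_sub _ _ hz hw
  have h2 := digamma_sub_integrable _ _ hz hw
  rw [← Complex.sub_re, h1]
  have h3 := integral_re h2
  simp only [RCLike.re_to_complex] at h3
  rw [← h3]
  have h4 := MeasureTheory.integral_comp_mul_left_Ioi (fun v : ℝ => ((cexp (-(1/2 + I * t / 2) * v) - cexp (-(1/4 + I * u / 2) * v)) / (1 - cexp (-v))).re) 0 (b := 2) two_pos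
  rw [mul_zero] at h4
  have h5 : ∫ v in Set.Ioi (0:ℝ), ((cexp (-(1/2 + I * t / 2) * v) - cexp (-(1/4 + I * u / 2) * v)) / (1 - cexp (-v))).re
      = 2 * ∫ x in Set.Ioi (0:ℝ), ((cexp (-(1/2 + I * t / 2) * (2 * x : ℝ)) - cexp (-(1/4 + I * u / 2) * (2 * x : ℝ))) / (1 - cexp (-(2 * x : ℝ)))).re := by
    rw [h4, smul_eq_mul]; ring
  rw [h5, ← MeasureTheory.integral_const_mul]
  refine MeasureTheory.setIntegral_congr_fun measurableSet_Ioi (fun x hx => ?_)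
  have hx' : (0:ℝ) < x := hx
  have e1 : cexp (-(1/2 + I * t / 2) * (2 * x : ℝ)) = (Real.exp (-x) : ℂ) * cexp ((-(t * x) : ℝ) * I) := by
    push_cast; rw [← Complex.exp_add]; congr 1; ring
  have e2 : cexp (-(1/4 + I * u / 2) * (2 * x : ℝ)) = (Real.exp (-x/2) : ℂ) * cexp ((-(u * x) : ℝ) * I) := by
    push_cast; rw [← Complex.exp_add]; congr 1; ring
  have e3 : 1 - cexp (-(2 * x : ℝ)) = ((1 - Real.exp (-(2 * x)) : ℝ) : ℂ) := by push_cast; rfl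
  rw [e1, e2, e3, Complex.div_ofReal_re, Complex.sub_re, Complex.re_ofReal_mul, Complex.re_ofReal_mul, Complex.exp_ofReal_mul_I_re,
    Complex.exp_ofReal_mul_I_re, Real.cos_neg, Real.cos_neg]
  unfold GK
  have hs : Real.sinh x = Real.exp x * (1 - Real.exp (-(2*x))) / 2 := by
    rw [Real.sinh_eq, mul_sub, ← Real.exp_add]; ring_nf
  have h6 : 1 - Real.exp (-(2 * x)) ≠ 0 := by
    have := aux_exp_lt_one (x := -(2 * x)) (by linarith)
    exact (by linarith : 0 < 1 - Real.exp (-(2 * x))).ne'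
  rw [hs, Real.exp_neg x, show -x/2 = x/2 - x by ring, Real.exp_sub]
  have := (Real.exp_pos x).ne'
  field_simp

lemma one_sub_cos_le (y : ℝ) : |1 - Real.cos y| ≤ 2 * √|y| := by
  have h1 := Real.cos_le_one y
  have h2 := Real.neg_one_le_cos y
  rw [abs_of_nonneg (by linarith)]
  rcases le_total 1 |y| with h | h
  · have : 1 ≤ √|y| := Real.one_le_sqrt.mpr h
    linarith
  · have h3 := Real.one_sub_sq_div_two_le_cos (x := y)
    have h4 : |y| ≤ √|y| := by
      apply Real.le_sqrt_of_sq_le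
      nlinarith [abs_nonneg y]
    have h5 : y^2 ≤ |y| := by
      rw [← sq_abs]; nlinarith [abs_nonneg y]
    linarith [abs_nonneg y]

noncomputable def BK (t x : ℝ) : ℝ := Real.exp (-x/2) * (1 + 2 * x) * ((2 * √|t| + 2) / √x + 1/2)

lemma BK_int (t : ℝ) : MeasureTheory.IntegrableOn (BK t) (Set.Ioi 0) := by
  have h := fun s (hs : (-1:ℝ) < s) => integrableOn_rpow_mul_exp_neg_mul_rpow (p := 1) (s := s) (b := 1/2) hs one_pos (by norm_num)
  have h1 := (h (-1/2) (by norm_num)).const_mul (2 * √|t| + 2)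
  have h2 := (h (1/2) (by norm_num)).const_mul (2 * (2 * √|t| + 2))
  have h3 := (h 0 (by norm_num)).const_mul (1/2)
  have h4 := (h 1 (by norm_num))
  refine MeasureTheory.IntegrableOn.congr_fun (((h1.add h2).add h3).add h4) (fun x hx => ?_) measurableSet_Ioi
  have hx' : (0:ℝ) < x := hx
  have hsq := Real.sqrt_pos.mpr hx'
  have e1 : x ^ (-1/2 : ℝ) = 1 / √x := by
    rw [show (-1/2:ℝ) = -(1/2) by norm_num, Real.rpow_neg hx'.le, ← Real.sqrt_eq_rpow, one_div]
  have e2 : x ^ (1/2 : ℝ) = √x := by rw [← Real.sqrt_eq_rpow]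
  have e3 : Real.exp (-(1/2) * x) = Real.exp (-x/2) := by congr 1; ring
  have e4 : x = √x * √x := (Real.mul_self_sqrt hx'.le).symm
  simp only [Pi.add_apply, Real.rpow_one, Real.rpow_zero]
  rw [e1, e2, e3]
  unfold BK
  have : 2 * x * ((2 * √|t| + 2) / √x) = 2 * (2 * √|t| + 2) * √x := by
    nth_rewrite 1 [e4]; field_simp
  linear_combination (- Real.exp (-x/2)) * this

lemma GK_bound (t u x : ℝ) (hx : 0 < x) : |GK t u x| ≤ (1 + √|u|) * BK t x := by
  unfold GK
  have hs : 0 < Real.sinh x := Real.sinh_pos_iff.mpr hx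
  have hsq := Real.sqrt_pos.mpr hx
  rw [abs_div, abs_of_pos hs]
  have hE : 1 ≤ Real.exp (x/2) := Real.one_le_exp (by linarith)
  have n1 : |Real.cos (t * x) - Real.exp (x/2) * Real.cos (u * x)| ≤
      Real.exp (x/2) * (2 * √|t| * √x + x / 2 + 2 * √|u| * √x) := by
    have a1 := one_sub_cos_le (t * x)
    have a2 := one_sub_cos_le (u * x)
    rw [abs_mul, abs_of_pos hx, Real.sqrt_mul (abs_nonneg _)] at a1 a2
    have a3 : |1 - Real.exp (x/2)| ≤ x / 2 * Real.exp (x/2) := by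
      rw [abs_of_nonpos (by linarith)]
      have := Real.add_one_le_exp (-(x/2))
      have h3 : Real.exp (x/2) * Real.exp (-(x/2)) = 1 := by rw [← Real.exp_add]; simp
      nlinarith
    have : Real.cos (t * x) - Real.exp (x/2) * Real.cos (u * x) = -(1 - Real.cos (t * x)) + (1 - Real.exp (x/2)) + Real.exp (x/2) * (1 - Real.cos (u * x)) := by ring
    rw [this]
    refine (abs_add_three _ _ _).trans ?_
    rw [abs_neg, abs_mul, abs_of_pos (Real.exp_pos _)]
    have a4 : 2 * (√|t| * √x) ≤ Real.exp (x/2) * (2 * (√|t| * √x)) := le_mul_of_one_le_left (by positivity) hE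
    have a5 := mul_le_mul_of_nonneg_left a2 (Real.exp_pos (x/2)).le
    linarith
  have n2 : 1 / Real.sinh x ≤ Real.exp (-x) * (1 + 2 * x) / x := by
    have h := aux_div_le (2 * x) (by linarith)
    have h6 : 0 < 1 - Real.exp (-(2 * x)) := by
      have := aux_exp_lt_one (x := -(2 * x)) (by linarith)
      linarith
    have hs : Real.sinh x = Real.exp x * (1 - Real.exp (-(2*x))) / 2 := by
      rw [Real.sinh_eq, mul_sub, ← Real.exp_add]; ring_nf
    have : 1 / Real.sinh x = Real.exp (-x) / x * (2 * x / (1 - Real.exp (-(2 * x)))) := by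
      rw [hs, Real.exp_neg x]
      have := (Real.exp_pos x).ne'
      field_simp
    rw [this]
    calc _ ≤ Real.exp (-x) / x * (1 + 2 * x) := by gcongr
      _ = _ := by ring
  calc _ ≤ Real.exp (x/2) * (2 * √|t| * √x + x / 2 + 2 * √|u| * √x) / Real.sinh x := by gcongr
    _ = Real.exp (x/2) * (2 * √|t| * √x + x / 2 + 2 * √|u| * √x) * (1 / Real.sinh x) := by ring
    _ ≤ Real.exp (x/2) * (2 * √|t| * √x + x / 2 + 2 * √|u| * √x) * (Real.exp (-x) * (1 + 2 * x) / x) := by gcongr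
    _ = Real.exp (-x/2) * (1 + 2 * x) * ((2 * √|t| + 2 * √|u|) / √x + 1/2) := by
      have e : Real.exp (x/2) * Real.exp (-x) = Real.exp (-x/2) := by rw [← Real.exp_add]; congr 1; ring
      rw [← e]
      have e5 : (2 * √|t| * √x + x / 2 + 2 * √|u| * √x) / x = (2 * √|t| + 2 * √|u|) / √x + 1/2 := by
        have gen : ∀ r A B : ℝ, 0 < r → (2 * A * r + r * r / 2 + 2 * B * r) / (r * r) = (2 * A + 2 * B) / r + 1/2 := by
          intro r A B hr
          field_simp
          ring
        have h := gen √x √|t| √|u| hsq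
        rwa [Real.mul_self_sqrt hx.le] at h
      rw [← e5]
      ring
    _ ≤ Real.exp (-x/2) * (1 + 2 * x) * ((1 + √|u|) * ((2 * √|t| + 2) / √x + 1/2)) := by
      gcongr
      have : (1 + √|u|) * ((2 * √|t| + 2) / √x + 1/2) - ((2 * √|t| + 2 * √|u|) / √x + 1/2)
        = 2 / √x + 2 * √|u| * √|t| / √x + √|u| / 2 := by field_simp; ring
      have h2 : 0 ≤ 2 / √x + 2 * √|u| * √|t| / √x + √|u| / 2 := by positivity
      linarith
    _ = _ := by unfold BK; ring

lemma PK_sqrt_int (t : ℝ) : MeasureTheory.Integrable (fun u => PK (t - u) * (1 + √|u|)) := by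
  have h0 : MeasureTheory.Integrable (fun s => PK s * √|s|) := by
    have h := (integrable_rpow_neg_one_add_norm_sq (E := ℝ) (μ := MeasureTheory.volume) (r := 3/2) (by simp; norm_num)).const_mul 2
    refine h.mono' (PK_cont.mul (by fun_prop)).aestronglyMeasurable (Filter.Eventually.of_forall fun s => ?_)
    have hp : 0 < 1 + s^2 := by positivity
    rw [Real.norm_of_nonneg (mul_nonneg (PK_pos s).le (Real.sqrt_nonneg _)), Real.norm_eq_abs, sq_abs]
    have h1 : √|s| ≤ (1 + s^2) ^ (1/4 : ℝ) := by
      have : (1 + s^2) ^ (1/4 : ℝ) = √(√(1 + s^2)) := by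
        rw [Real.sqrt_eq_rpow, Real.sqrt_eq_rpow, ← Real.rpow_mul hp.le]; norm_num
      rw [this]
      apply Real.sqrt_le_sqrt
      apply Real.le_sqrt_of_sq_le
      rw [sq_abs]; linarith
    calc PK s * √|s| ≤ 2 * (1 + s^2)⁻¹ * (1 + s^2) ^ (1/4 : ℝ) := by
          gcongr
          exact PK_le s
      _ = 2 * (1 + s^2) ^ (-(3/2)/2 : ℝ) := by
          rw [mul_assoc, ← Real.rpow_neg_one, ← Real.rpow_add hp]; norm_num
  have h1 : MeasureTheory.Integrable (fun s => PK s * (1 + √|t - s|)) := by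
    have h2 := (PK_int.const_mul (1 + √|t|)).add h0
    refine h2.mono' (PK_cont.mul (by fun_prop)).aestronglyMeasurable (Filter.Eventually.of_forall fun s => ?_)
    rw [Real.norm_of_nonneg (mul_nonneg (PK_pos s).le (by positivity))]
    have h3 : √|t - s| ≤ √|t| + √|s| := by
      refine (Real.sqrt_le_sqrt (abs_sub t s)).trans ?_
      rw [Real.sqrt_le_left (by positivity)]
      nlinarith [Real.sq_sqrt (abs_nonneg t), Real.sq_sqrt (abs_nonneg s), Real.sqrt_nonneg |t|, Real.sqrt_nonneg |s|, mul_nonneg (Real.sqrt_nonneg |t|) (Real.sqrt_nonneg |s|)]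
    simp only [Pi.add_apply]
    nlinarith [mul_le_mul_of_nonneg_left h3 (PK_pos s).le]
  have := h1.comp_sub_left t
  simpa using this

lemma HK_le (θ c x : ℝ) : |HK θ c x| ≤ PK x * ((Real.exp (θ / 2) + Real.exp (-(θ / 2)) + 2) / |c|) := by
  unfold HK
  rw [abs_mul, abs_of_pos (PK_pos x), abs_div]
  have := PK_pos x
  gcongr
  rw [abs_le]
  have h1 := Real.cos_le_one (θ * x)
  have h2 := Real.neg_one_le_cos (θ * x)
  have := Real.exp_pos (θ/2)
  have := Real.exp_pos (-(θ/2))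
  constructor <;> linarith

lemma prod_int (θ c t : ℝ) : MeasureTheory.Integrable (fun p : ℝ × ℝ => HK θ c (t - p.1) * GK t p.1 p.2)
    (MeasureTheory.volume.prod (MeasureTheory.volume.restrict (Set.Ioi 0))) := by
  set C := (Real.exp (θ / 2) + Real.exp (-(θ / 2)) + 2) / |c| with hC
  have hC0 : 0 ≤ C := by positivity
  have h1 := (((PK_sqrt_int t).const_mul C).mul_prod (BK_int t))
  refine h1.mono' ?_ ?_
  · apply Measurable.aestronglyMeasurable
    have := (HK_cont θ c).measurable
    unfold GK
    fun_prop
  · have : ∀ᵐ p : ℝ × ℝ ∂(MeasureTheory.volume.prod (MeasureTheory.volume.restrict (Set.Ioi 0))), p.2 ∈ Set.Ioi (0:ℝ) := by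
      have hr : ∀ᵐ x : ℝ ∂(MeasureTheory.volume.restrict (Set.Ioi (0:ℝ))), x ∈ Set.Ioi (0:ℝ) :=
        MeasureTheory.ae_restrict_mem measurableSet_Ioi
      exact MeasureTheory.Measure.quasiMeasurePreserving_snd.ae hr
    filter_upwards [this] with p hp
    rw [Real.norm_eq_abs, abs_mul]
    have a1 := HK_le θ c (t - p.1)
    have a2 := GK_bound t p.1 p.2 hp
    calc _ ≤ (PK (t - p.1) * C) * ((1 + √|p.1|) * BK t p.2) := by
          apply mul_le_mul a1 a2 (abs_nonneg _)
          exact mul_nonneg (PK_pos _).le hC0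
      _ = _ := by ring

lemma HK_int (θ c : ℝ) : MeasureTheory.Integrable (HK θ c) := by
  refine (PK_int.mul_const ((Real.exp (θ / 2) + Real.exp (-(θ / 2)) + 2) / |c|)).mono' (HK_cont θ c).aestronglyMeasurable
    (Filter.Eventually.of_forall fun x => HK_le θ c x)

lemma HK_cos_int (θ c t x : ℝ) : MeasureTheory.Integrable (fun u => HK θ c (t - u) * Real.cos (u * x)) := by
  have h := (HK_int θ c).comp_sub_left t
  refine h.mono (((HK_cont θ c).comp (by fun_prop)).mul (by fun_prop)).aestronglyMeasurable (Filter.Eventually.of_forall fun x => ?_)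
  rw [norm_mul]
  exact mul_le_of_le_one_right (norm_nonneg _) (Real.abs_cos_le_one _)

lemma main_fubini (θ c t : ℝ) (hθ : 0 < θ) :
    ∫ u : ℝ, HK θ c (t - u) * (digamma (1/4 + I * u / 2)).re =
      Real.pi * ((Real.exp (θ / 2) - Real.exp (-(θ / 2))) / c) * (digamma (1/2 + I * t / 2)).re +
      Real.pi / c * ∫ x in Set.Ioi (0:ℝ), Real.cos (t * x) * (((Real.exp (θ / 2) - Real.exp (-(θ / 2))) -
        max (Real.exp (θ / 2) - Real.exp (-(θ / 2)) * Real.exp x) 0) / Real.sinh x) := by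
  set R := (digamma (1/2 + I * t / 2)).re with hR
  have hH := (HK_int θ c).comp_sub_left t
  have hpi := prod_int θ c t
  have hHv : ∫ u : ℝ, HK θ c (t - u) = Real.pi * ((Real.exp (θ / 2) - Real.exp (-(θ / 2))) / c) := by
    have := HK_conv θ c t 0 hθ le_rfl
    simp only [mul_zero, Real.cos_zero, mul_one, neg_zero, zero_div, Real.exp_zero, one_mul] at this
    rw [this, max_eq_left]
    have : Real.exp (-(θ/2)) ≤ Real.exp (θ/2) := Real.exp_le_exp.mpr (by linarith)
    linarith
  have h1 : ∀ u : ℝ, HK θ c (t - u) * (digamma (1/4 + I * u / 2)).re =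
      HK θ c (t - u) * R + ∫ x in Set.Ioi (0:ℝ), HK θ c (t - u) * GK t u x := by
    intro u
    rw [MeasureTheory.integral_const_mul, ← digamma_re_sub]
    ring
  simp_rw [h1]
  rw [MeasureTheory.integral_add (hH.mul_const R) hpi.integral_prod_left, MeasureTheory.integral_mul_const, hHv]
  congr 1
  rw [MeasureTheory.integral_integral_swap hpi, ← MeasureTheory.integral_const_mul]
  refine MeasureTheory.setIntegral_congr_fun measurableSet_Ioi (fun x hx => ?_)
  have hx' : (0:ℝ) < x := hx
  simp only
  have h2 : ∀ u, HK θ c (t - u) * GK t u x = Real.cos (t * x) / Real.sinh x * HK θ c (t - u) -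
      Real.exp (x / 2) / Real.sinh x * (HK θ c (t - u) * Real.cos (u * x)) := by
    intro u; unfold GK; ring
  simp_rw [h2]
  rw [MeasureTheory.integral_sub (hH.const_mul _) ((HK_cos_int θ c t x).const_mul _), MeasureTheory.integral_const_mul,
    MeasureTheory.integral_const_mul, HK_conv θ c t x hθ hx'.le, hHv]
  have h3 : max (Real.exp (θ / 2) - Real.exp (-(θ / 2)) * Real.exp x) 0 =
      Real.exp (x/2) * max (Real.exp (θ / 2) * Real.exp (-x / 2) - Real.exp (-(θ / 2)) * Real.exp (x / 2)) 0 := by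
    rw [mul_max_of_nonneg _ _ (Real.exp_pos _).le, mul_zero]
    congr 1
    have e1 : Real.exp (x/2) * Real.exp (-x/2) = 1 := by rw [← Real.exp_add]; ring_nf; exact Real.exp_zero
    have e2 : Real.exp (x/2) * Real.exp (x/2) = Real.exp x := by rw [← Real.exp_add]; ring_nf
    linear_combination (-Real.exp (θ/2)) * e1 + Real.exp (-(θ/2)) * e2
  rw [h3]
  ring


lemma ibp_bound (t p q σ : ℝ) (ht : 0 < t) (hpq : p ≤ q) (hσ : |σ| = 1) (f f' f'' : ℝ → ℝ)
    (hf : ∀ x ∈ Set.Icc p q, HasDerivAt f (f' x) x) (hf' : ∀ x ∈ Set.Icc p q, HasDerivAt f' (f'' x) x)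
    (hc : ContinuousOn f'' (Set.Icc p q)) (hs : ∀ x ∈ Set.Icc p q, 0 ≤ σ * f'' x) :
    |(∫ x in p..q, Real.cos (t * x) * f x) -
      ((Real.sin (t * q) * f q / t + Real.cos (t * q) * f' q / t^2) -
       (Real.sin (t * p) * f p / t + Real.cos (t * p) * f' p / t^2))| ≤ σ * (f' q - f' p) / t^2 := by
  have hu : Set.uIcc p q = Set.Icc p q := Set.uIcc_of_le hpq
  have cf : ContinuousOn f (Set.Icc p q) := fun x hx => (hf x hx).continuousAt.continuousWithinAt
  have dsin : ∀ x : ℝ, HasDerivAt (fun x => Real.sin (t * x)) (Real.cos (t * x) * t) x := fun x => by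
    have := ((hasDerivAt_id x).const_mul t).sin
    simpa using this
  have dcos : ∀ x : ℝ, HasDerivAt (fun x => Real.cos (t * x)) (-Real.sin (t * x) * t) x := fun x => by
    have := ((hasDerivAt_id x).const_mul t).cos
    simpa using this
  have hW : ∀ x ∈ Set.uIcc p q, HasDerivAt (fun x => Real.sin (t * x) * f x / t + Real.cos (t * x) * f' x / t^2)
      (Real.cos (t * x) * f x + Real.cos (t * x) * f'' x / t^2) x := by
    intro x hx
    rw [hu] at hx
    have h1 := ((dsin x).mul (hf x hx)).div_const t
    have h2 := ((dcos x).mul (hf' x hx)).div_const (t^2)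
    refine HasDerivAt.congr_deriv (h1.add h2) ?_
    field_simp
    ring
  have i1 : IntervalIntegrable (fun x => Real.cos (t * x) * f x) MeasureTheory.volume p q := by
    apply ContinuousOn.intervalIntegrable
    rw [hu]
    exact ContinuousOn.mul (by fun_prop) cf
  have i2 : IntervalIntegrable (fun x => Real.cos (t * x) * f'' x / t^2) MeasureTheory.volume p q := by
    apply ContinuousOn.intervalIntegrable
    rw [hu]
    exact (ContinuousOn.mul (by fun_prop) hc).div_const _
  have i3 : IntervalIntegrable f'' MeasureTheory.volume p q := by
    apply ContinuousOn.intervalIntegrable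
    rwa [hu]
  have h1 := intervalIntegral.integral_eq_sub_of_hasDerivAt hW (i1.add i2)
  rw [intervalIntegral.integral_add i1 i2] at h1
  have h2 := intervalIntegral.integral_eq_sub_of_hasDerivAt (f := f') (f' := f'') (by rwa [hu]) i3
  rw [← h1, ← h2]
  have : (∫ x in p..q, Real.cos (t * x) * f x) - ((∫ x in p..q, Real.cos (t * x) * f x) + ∫ x in p..q, Real.cos (t * x) * f'' x / t^2)
     = - ∫ x in p..q, Real.cos (t * x) * f'' x / t^2 := by ring
  rw [this, abs_neg, mul_div_right_comm, ← intervalIntegral.integral_const_mul, ← Real.norm_eq_abs]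
  refine intervalIntegral.norm_integral_le_of_norm_le hpq ?_ (i3.const_mul _)
  refine Filter.Eventually.of_forall fun x hx => ?_
  have hx' : x ∈ Set.Icc p q := ⟨hx.1.le, hx.2⟩
  have h3 := hs x hx'
  have h4 : |f'' x| = σ * f'' x := by
    rw [← abs_of_nonneg h3, abs_mul, hσ, one_mul]
  rw [Real.norm_eq_abs, abs_div, abs_mul, h4, abs_of_pos (show 0 < t^2 by positivity), mul_comm (σ / t^2), ← mul_div_assoc, mul_comm (f'' x)]
  exact div_le_div_of_nonneg_right (mul_le_of_le_one_left h3 (Real.abs_cos_le_one _)) (by positivity)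

lemma first_part (t θ b : ℝ) (ht : 0 < t) (hθ : 0 < θ) (hb : 0 < b) :
    |(∫ x in (0:ℝ)..θ, Real.cos (t * x) * (2 * b * Real.exp x / (1 + Real.exp x)))
      - Real.sin (t * θ) * (2 * b * Real.exp θ / (1 + Real.exp θ)) / t| ≤ b / t^2 := by
  set f : ℝ → ℝ := fun x => 2 * b * Real.exp x / (1 + Real.exp x) with hf
  set f' : ℝ → ℝ := fun x => 2 * b * Real.exp x / (1 + Real.exp x)^2 with hf'
  set f'' : ℝ → ℝ := fun x => 2 * b * Real.exp x * (1 - Real.exp x) / (1 + Real.exp x)^3 with hf''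
  have hp : ∀ x : ℝ, 0 < 1 + Real.exp x := fun x => by positivity
  have d0 : ∀ x : ℝ, HasDerivAt (fun x => 2 * b * Real.exp x) (2 * b * Real.exp x) x := fun x =>
    (Real.hasDerivAt_exp x).const_mul _
  have d1 : ∀ x : ℝ, HasDerivAt (fun x => 1 + Real.exp x) (Real.exp x) x := fun x =>
    (Real.hasDerivAt_exp x).const_add _
  have df : ∀ x, HasDerivAt f (f' x) x := fun x => by
    refine HasDerivAt.congr_deriv ((d0 x).div (d1 x) (hp x).ne') ?_
    simp only [hf']
    congr 1
    ring
  have df' : ∀ x, HasDerivAt f' (f'' x) x := fun x => by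
    refine HasDerivAt.congr_deriv ((d0 x).div ((d1 x).pow 2) (pow_pos (hp x) 2).ne') ?_
    simp only [hf'', Pi.pow_apply]
    have := (hp x).ne'
    field_simp
    push_cast
    ring
  have h := ibp_bound t 0 θ (-1) ht hθ.le (by simp) f f' f'' (fun x _ => df x) (fun x _ => df' x)
    (by
      apply Continuous.continuousOn
      refine Continuous.div (by fun_prop) (by fun_prop) (fun x => (pow_pos (hp x) 3).ne'))
    (by
      intro x hx
      have h1 : 1 ≤ Real.exp x := Real.one_le_exp hx.1
      have h2 := Real.exp_pos x
      simp only [hf'']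
      rw [← mul_div_assoc]
      apply div_nonneg _ (pow_pos (hp x) 3).le
      have : 0 ≤ b * Real.exp x * (Real.exp x - 1) := mul_nonneg (by positivity) (by linarith)
      linarith)
  have h0 : f' 0 = b / 2 := by simp [hf']; ring
  have hθ' : 0 ≤ f' θ := by simp only [hf']; positivity
  rw [h0] at h
  simp only [mul_zero, Real.sin_zero, Real.cos_zero, zero_mul, zero_div, one_mul, zero_add] at h
  have hcos := Real.abs_cos_le_one (t * θ)
  have h5 : |Real.cos (t * θ) * f' θ / t^2| ≤ f' θ / t^2 := by
    rw [abs_div, abs_mul, abs_of_nonneg hθ', abs_of_pos (show 0 < t^2 by positivity)]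
    gcongr
    exact mul_le_of_le_one_left hθ' hcos
  have e1 : -1 * (f' θ - b/2) / t^2 = b/2/t^2 - f' θ / t^2 := by ring
  have e2 : b / t^2 = b/2/t^2 + b/2/t^2 := by ring
  rw [e1] at h
  rw [e2]
  rw [abs_le] at h h5 ⊢
  have : 0 ≤ b/2/t^2 := by positivity
  constructor <;> linarith [h.1, h.2, h5.1, h5.2]

lemma tail_int (θ : ℝ) (hθ : 0 < θ) : MeasureTheory.IntegrableOn (fun x => 1 / Real.sinh x) (Set.Ioi θ) := by
  have h6 : 0 < 1 - Real.exp (-(2 * θ)) := by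
    have := aux_exp_lt_one (x := -(2 * θ)) (by linarith)
    linarith
  have h := (integrableOn_exp_mul_Ioi (a := -1) (by norm_num) θ).const_mul (2 / (1 - Real.exp (-(2 * θ))))
  refine MeasureTheory.Integrable.mono' h ?_ ?_
  · apply Measurable.aestronglyMeasurable
    fun_prop
  · refine (MeasureTheory.ae_restrict_iff' measurableSet_Ioi).mpr (Filter.Eventually.of_forall fun x hx => ?_)
    have hx' : θ < x := hx
    have hs : Real.sinh x = Real.exp x * (1 - Real.exp (-(2*x))) / 2 := by
      rw [Real.sinh_eq, mul_sub, ← Real.exp_add]; ring_nf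
    have h7 : Real.exp (-(2 * x)) ≤ Real.exp (-(2 * θ)) := Real.exp_le_exp.mpr (by linarith)
    have hs0 : 0 < Real.sinh x := Real.sinh_pos_iff.mpr (by linarith)
    rw [Real.norm_of_nonneg (by positivity)]
    rw [div_le_iff₀ hs0, hs, show -1 * x = -x by ring, Real.exp_neg x]
    have := (Real.exp_pos x).ne'
    have e : 2 / (1 - Real.exp (-(2 * θ))) * (Real.exp x)⁻¹ * (Real.exp x * (1 - Real.exp (-(2 * x))) / 2) = (1 - Real.exp (-(2 * x))) / (1 - Real.exp (-(2 * θ))) := by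
      field_simp
    rw [e, le_div_iff₀ h6]
    linarith

lemma second_part (t θ C : ℝ) (ht : 0 < t) (hθ : 0 < θ) (hC : 0 < C) :
    |(∫ x in Set.Ioi θ, Real.cos (t * x) * (C / Real.sinh x))
      + Real.sin (t * θ) * (C / Real.sinh θ) / t| ≤ 2 * (C * Real.cosh θ / Real.sinh θ ^ 2) / t^2 := by
  set f : ℝ → ℝ := fun x => C / Real.sinh x with hf
  set f' : ℝ → ℝ := fun x => - (C * Real.cosh x) / Real.sinh x ^ 2 with hf'
  set f'' : ℝ → ℝ := fun x => C * (Real.cosh x ^ 2 + 1) / Real.sinh x ^ 3 with hf''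
  have hp : ∀ x : ℝ, 0 < x → 0 < Real.sinh x := fun x hx => Real.sinh_pos_iff.mpr hx
  have df : ∀ x, 0 < x → HasDerivAt f (f' x) x := fun x hx => by
    refine HasDerivAt.congr_deriv ((hasDerivAt_const x C).div (Real.hasDerivAt_sinh x) (hp x hx).ne') ?_
    simp only [hf']
    congr 1
    ring
  have df' : ∀ x, 0 < x → HasDerivAt f' (f'' x) x := fun x hx => by
    refine HasDerivAt.congr_deriv ((((Real.hasDerivAt_cosh x).const_mul C).neg).div ((Real.hasDerivAt_sinh x).pow 2) (pow_pos (hp x hx) 2).ne') ?_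
    simp only [hf'', Pi.pow_apply, Pi.neg_apply]
    have := (hp x hx).ne'
    have hcs := Real.cosh_sq x
    field_simp
    push_cast
    rw [hcs]
    linear_combination (-2 * Real.sinh x ^ 2) * hcs + 2 * Real.sinh x^2 * hcs + 2 * hcs - 2 * hcs
  have hintg : MeasureTheory.IntegrableOn (fun x => Real.cos (t * x) * f x) (Set.Ioi θ) := by
    have h := (tail_int θ hθ).const_mul C
    refine MeasureTheory.Integrable.mono h ?_ ?_
    · apply Measurable.aestronglyMeasurable
      simp only [hf]
      fun_prop
    · refine Filter.Eventually.of_forall fun x => ?_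
      rw [norm_mul, mul_one_div]
      exact mul_le_of_le_one_left (norm_nonneg _) (Real.abs_cos_le_one _)
  have hlim := MeasureTheory.intervalIntegral_tendsto_integral_Ioi θ hintg Filter.tendsto_id
  have hb : ∀ R, θ ≤ R → |(∫ x in θ..R, Real.cos (t * x) * f x) -
      ((Real.sin (t * R) * f R / t + Real.cos (t * R) * f' R / t^2) -
       (Real.sin (t * θ) * f θ / t + Real.cos (t * θ) * f' θ / t^2))| ≤ 1 * (f' R - f' θ) / t^2 := by
    intro R hR
    have hpos : ∀ x ∈ Set.Icc θ R, 0 < x := fun x hx => lt_of_lt_of_le hθ hx.1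
    refine ibp_bound t θ R 1 ht hR (by simp) f f' f'' (fun x hx => df x (hpos x hx)) (fun x hx => df' x (hpos x hx)) ?_ ?_
    · refine ContinuousOn.div (by fun_prop) (by fun_prop) (fun x hx => (pow_pos (hp x (hpos x hx)) 3).ne')
    · intro x hx
      have := hp x (hpos x hx)
      simp only [hf'']
      positivity
  have hinv : Filter.Tendsto (fun R : ℝ => R⁻¹) Filter.atTop (nhds 0) := tendsto_inv_atTop_zero
  have lf : Filter.Tendsto f Filter.atTop (nhds 0) := by
    have h0 : Filter.Tendsto (fun R : ℝ => C * R⁻¹) Filter.atTop (nhds 0) := by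
      simpa using hinv.const_mul C
    refine squeeze_zero' ?_ ?_ h0
    · filter_upwards [Filter.eventually_gt_atTop 0] with x hx
      have := hp x hx
      simp only [hf]; positivity
    · filter_upwards [Filter.eventually_gt_atTop 0] with x hx
      have h1 : x ≤ Real.sinh x := Real.self_le_sinh_iff.mpr hx.le
      simp only [hf, ← div_eq_mul_inv]
      gcongr
  have lf' : Filter.Tendsto f' Filter.atTop (nhds 0) := by
    have h0 : Filter.Tendsto (fun R : ℝ => C * (R⁻¹ + R⁻¹^2)) Filter.atTop (nhds 0) := by
      simpa using (hinv.add (hinv.pow 2)).const_mul C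
    refine squeeze_zero_norm' ?_ h0
    filter_upwards [Filter.eventually_gt_atTop 0] with x hx
    have h1 : x ≤ Real.sinh x := Real.self_le_sinh_iff.mpr hx.le
    have h2 : Real.cosh x ≤ Real.sinh x + 1 := by
      have := Real.cosh_sub_sinh x
      have h3 : Real.exp (-x) ≤ 1 := (aux_exp_lt_one (by linarith)).le
      linarith
    have h3 := hp x hx
    have h4 := Real.cosh_pos x
    simp only [hf']
    rw [norm_div, norm_neg, Real.norm_of_nonneg (by positivity), Real.norm_of_nonneg (by positivity)]
    calc C * Real.cosh x / Real.sinh x ^ 2 ≤ C * (Real.sinh x + 1) / Real.sinh x ^ 2 := by gcongr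
      _ = C * ((Real.sinh x)⁻¹ + (Real.sinh x)⁻¹^2) := by field_simp
      _ ≤ _ := by gcongr
  have bsin : Filter.Tendsto (fun R => Real.sin (t * R) * f R) Filter.atTop (nhds 0) := by
    refine squeeze_zero_norm (fun R => ?_) (by simpa using lf.norm)
    rw [norm_mul]
    exact mul_le_of_le_one_left (norm_nonneg _) (Real.abs_sin_le_one _)
  have bcos : Filter.Tendsto (fun R => Real.cos (t * R) * f' R) Filter.atTop (nhds 0) := by
    refine squeeze_zero_norm (fun R => ?_) (by simpa using lf'.norm)
    rw [norm_mul]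
    exact mul_le_of_le_one_left (norm_nonneg _) (Real.abs_cos_le_one _)
  have hL := (hlim.sub (((bsin.div_const t).add (bcos.div_const (t^2))).sub_const
    (Real.sin (t * θ) * f θ / t + Real.cos (t * θ) * f' θ / t^2))).abs
  have hR := ((lf'.sub_const (f' θ)).const_mul 1).div_const (t^2)
  have hfin := le_of_tendsto_of_tendsto hL hR (by
    filter_upwards [Filter.eventually_ge_atTop θ] with R hR
    exact hb R hR)
  simp only [zero_div, zero_add, zero_sub, sub_neg_eq_add, one_mul] at hfin
  have e : C * Real.cosh θ / Real.sinh θ ^ 2 = - f' θ := by simp only [hf']; ring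
  have hneg : 0 ≤ - f' θ := by
    rw [← e]
    have := hp θ hθ
    have := Real.cosh_pos θ
    positivity
  rw [e]
  have h5 : |Real.cos (t * θ) * f' θ / t^2| ≤ - f' θ / t^2 := by
    rw [abs_div, abs_mul, abs_of_nonpos (show f' θ ≤ 0 by linarith), abs_of_pos (show 0 < t^2 by positivity)]
    gcongr
    exact mul_le_of_le_one_left hneg (Real.abs_cos_le_one _)
  have e2 : 2 * (- f' θ) / t^2 = - f' θ / t^2 + - f' θ / t^2 := by ring
  rw [e2]
  rw [abs_le] at hfin h5 ⊢
  constructor <;> linarith [hfin.1, hfin.2, h5.1, h5.2]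

lemma J_bound (t θ : ℝ) (ht : 0 < t) (hθ : 0 < θ) :
    |∫ x in Set.Ioi (0:ℝ), Real.cos (t * x) * (((Real.exp (θ / 2) - Real.exp (-(θ / 2))) -
        max (Real.exp (θ / 2) - Real.exp (-(θ / 2)) * Real.exp x) 0) / Real.sinh x)| ≤
    (Real.exp (-(θ/2)) + 2 * ((Real.exp (θ / 2) - Real.exp (-(θ / 2))) * Real.cosh θ / Real.sinh θ ^ 2)) / t^2 := by
  set a := Real.exp (θ/2) with ha
  set b := Real.exp (-(θ/2)) with hb
  have hb0 : 0 < b := Real.exp_pos _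
  have ha0 : 0 < a := Real.exp_pos _
  have hab : b < a := Real.exp_lt_exp.mpr (by linarith)
  have hab1 : a * b = 1 := by rw [ha, hb, ← Real.exp_add]; simp
  have haθ : a = b * Real.exp θ := by rw [ha, hb, ← Real.exp_add]; congr 1; ring
  have hsinh : ∀ x, Real.sinh x = (Real.exp x - 1) * (Real.exp x + 1) / (2 * Real.exp x) := by
    intro x
    rw [Real.sinh_eq, Real.exp_neg]
    have := (Real.exp_pos x).ne'
    field_simp
    ring
  have c1 : Set.EqOn (fun x => Real.cos (t * x) * (2 * b * Real.exp x / (1 + Real.exp x))) (fun x => Real.cos (t * x) * (((a - b) - max (a - b * Real.exp x) 0) / Real.sinh x)) (Set.Ioc 0 θ) := by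
    intro x hx
    have h1 : 1 < Real.exp x := Real.one_lt_exp_iff.mpr hx.1
    have h2 : Real.exp x ≤ Real.exp θ := Real.exp_le_exp.mpr hx.2
    simp only
    rw [max_eq_left (by rw [haθ]; nlinarith), hsinh]
    have h3 : Real.exp x - 1 ≠ 0 := by linarith
    have h4 : Real.exp x + 1 ≠ 0 := by linarith
    have h5 : 1 + Real.exp x ≠ 0 := by linarith
    have := (Real.exp_pos x).ne'
    field_simp
    ring
  have c2 : Set.EqOn (fun x => Real.cos (t * x) * ((a - b) / Real.sinh x)) (fun x => Real.cos (t * x) * (((a - b) - max (a - b * Real.exp x) 0) / Real.sinh x)) (Set.Ioi θ) := by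
    intro x hx
    have hx' : θ < x := hx
    have h2 : Real.exp θ ≤ Real.exp x := Real.exp_le_exp.mpr hx'.le
    simp only
    rw [max_eq_right (by rw [haθ]; nlinarith), sub_zero]
  have i1 : MeasureTheory.IntegrableOn (fun x => Real.cos (t * x) * (2 * b * Real.exp x / (1 + Real.exp x))) (Set.Ioc 0 θ) := by
    apply Continuous.integrableOn_Ioc
    refine Continuous.mul (by fun_prop) (Continuous.div (by fun_prop) (by fun_prop) (fun x => by positivity))
  have i2 : MeasureTheory.IntegrableOn (fun x => Real.cos (t * x) * ((a - b) / Real.sinh x)) (Set.Ioi θ) := by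
    have h := (tail_int θ hθ).const_mul (a - b)
    refine MeasureTheory.Integrable.mono h ?_ ?_
    · apply Measurable.aestronglyMeasurable
      fun_prop
    · refine Filter.Eventually.of_forall fun x => ?_
      rw [norm_mul, mul_one_div]
      exact mul_le_of_le_one_left (norm_nonneg _) (Real.abs_cos_le_one _)
  have i1' := i1.congr_fun c1 measurableSet_Ioc
  have i2' := i2.congr_fun c2 measurableSet_Ioi
  rw [← Set.Ioc_union_Ioi_eq_Ioi hθ.le, MeasureTheory.setIntegral_union (Set.Ioc_disjoint_Ioi le_rfl) measurableSet_Ioi i1' i2',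
    ← MeasureTheory.setIntegral_congr_fun measurableSet_Ioc c1, ← MeasureTheory.setIntegral_congr_fun measurableSet_Ioi c2,
    ← intervalIntegral.integral_of_le hθ.le]
  have f1 := first_part t θ b ht hθ hb0
  have f2 := second_part t θ (a - b) ht hθ (by linarith)
  have hmatch : 2 * b * Real.exp θ / (1 + Real.exp θ) = (a - b) / Real.sinh θ := by
    have h1 : 1 < Real.exp θ := Real.one_lt_exp_iff.mpr hθ
    rw [hsinh, haθ]
    have h3 : Real.exp θ - 1 ≠ 0 := by linarith
    have h4 : Real.exp θ + 1 ≠ 0 := by linarith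
    have h5 : 1 + Real.exp θ ≠ 0 := by linarith
    have := (Real.exp_pos θ).ne'
    field_simp
    ring
  rw [hmatch] at f1
  rw [add_div]
  rw [abs_le] at f1 f2 ⊢
  constructor <;> linarith [f1.1, f1.2, f2.1, f2.2]


lemma final_num (a ε : ℝ) (ha : 4 ≤ a) (hε : ε = 1 ∨ ε = -1) (b c : ℝ) (hab : a * b = 1) (hc : c = a + b - 2 * ε) :
    0 < c ∧ (a - b) / (2 * c) = 1 / 2 + 1 / (ε * a - 1) ∧ |(a - b) / (2 * c)| ≤ 5 / 6 ∧
    1 / (2 * c) ≤ 2 / 9 := by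
  have hb : b = 1 / a := by field_simp; linarith
  have hca : c = (a - ε)^2 / a := by
    rw [hc, hb]; rcases hε with rfl | rfl <;> field_simp <;> ring
  have h1 : a - ε ≠ 0 := by rcases hε with rfl | rfl <;> linarith
  have h3 : 9/4 ≤ c := by
    rw [hca, le_div_iff₀ (by linarith)]
    rcases hε with rfl | rfl <;> nlinarith
  have h2 : (a - b) / (2 * c) = 1 / 2 + 1 / (ε * a - 1) := by
    rw [hca, hb]
    rcases hε with rfl | rfl
    · have : a - 1 ≠ 0 := h1
      have h : 1 * a - 1 ≠ 0 := by rwa [one_mul]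
      field_simp
      ring
    · have : a + 1 ≠ 0 := by linarith
      have h : -1 * a - 1 ≠ 0 := by linarith
      have h' : a - -1 ≠ 0 := by linarith
      rw [show -1 * a - 1 = -(a+1) by ring, show a - -1 = a + 1 by ring]
      field_simp
      ring
  refine ⟨by linarith, h2, ?_, ?_⟩
  · rw [h2]
    rcases hε with rfl | rfl
    · have : 1 / (1 * a - 1) ≤ 1 / 3 := one_div_le_one_div_of_le (by norm_num) (by linarith)
      have h0 : 0 < 1 / (1 * a - 1) := one_div_pos.2 (by linarith)
      rw [abs_of_nonneg (by linarith)]; linarith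
    · rw [show -1 * a - 1 = -(a+1) by ring, one_div_neg_eq_neg_one_div]
      have : 1 / (a + 1) ≤ 1 / 5 := one_div_le_one_div_of_le (by norm_num) (by linarith)
      have h0 : 0 < 1 / (a + 1) := one_div_pos.2 (by linarith)
      rw [abs_of_nonneg (by linarith)]; linarith
  · rw [div_le_iff₀ (by linarith)]; linarith

lemma final_num2 (a b C S : ℝ) (ha : 4 ≤ a) (hab : a * b = 1) (hC : C = (a^2 + b^2)/2) (hS : S = (a^2 - b^2)/2) :
    b + 2 * ((a - b) * C / S^2) ≤ 1.4 := by
  have hb0 : 0 < b := by nlinarith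
  have hb : b ≤ 1/4 := by nlinarith
  have h : (a - b) * C / S^2 = 2 * (a^2+b^2) / ((a-b) * (a+b)^2) := by
    have : a - b ≠ 0 := by linarith
    have : a + b ≠ 0 := by linarith
    have h2 : S = (a-b)*(a+b)/2 := by rw [hS]; ring
    rw [hC, h2]
    field_simp
  have h2 : 2 * (a^2+b^2) / ((a-b) * (a+b)^2) ≤ 8/15 := by
    rw [div_le_iff₀ (mul_pos (by linarith) (by nlinarith))]
    have h4 : a^2+b^2 ≤ (a+b)^2 := by nlinarith
    have h5 : 15/4 ≤ a - b := by linarith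
    have h6 : 15/4 * (a+b)^2 ≤ (a-b)*(a+b)^2 := mul_le_mul_of_nonneg_right h5 (sq_nonneg _)
    linarith
  rw [h]; norm_num at *; linarith

/-- For `Δ ≥ 1/2` and real `t > 0`, for each fixed choice of sign `ε = ±1`
(with `c_Δ^± = (e^{πΔ/2} ∓ e^{−πΔ/2})²` and
`h_Δ^±(x) = ((1/2)/(1/4 + x²))(e^{πΔ} + e^{−πΔ} − 2cos(2πΔx))/c_Δ^±`), there is a real `E`
with `|E| ≤ 1.3/t²` such that
`(1/2π) ∫ h_Δ^±(t−u) Re(Γ'/Γ(1/4 + iu/2)) du = (1/2 + 1/(±e^{πΔ} − 1)) log(t/2) + E`. -/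
theorem gamma_term_expansion (Δ t ε : ℝ) (hε : ε = 1 ∨ ε = -1) (hΔ : 1 / 2 ≤ Δ)
    (ht : 0 < t) :
    ∃ E : ℝ, |E| ≤ 1.3 / t ^ 2 ∧
      (1 / (2 * Real.pi)) *
          (∫ u : ℝ,
            (((1 / 2) / (1 / 4 + (t - u) ^ 2)) *
              ((Real.exp (Real.pi * Δ) + Real.exp (-(Real.pi * Δ))
                  - 2 * Real.cos (2 * Real.pi * Δ * (t - u))) /
                (Real.exp (Real.pi * Δ / 2) - ε * Real.exp (-(Real.pi * Δ / 2))) ^ 2)) *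
            (deriv Complex.Gamma (1 / 4 + I * u / 2) /
              Complex.Gamma (1 / 4 + I * u / 2)).re)
        = (1 / 2 + 1 / (ε * Real.exp (Real.pi * Δ) - 1)) * Real.log (t / 2) + E := by
  have hpi := Real.pi_gt_three
  obtain ⟨θ, hθ⟩ : ∃ θ, θ = 2 * Real.pi * Δ := ⟨_, rfl⟩
  have hθ2 : Real.pi * Δ = θ / 2 := by rw [hθ]; ring
  have hθ0 : 3 ≤ θ := by rw [hθ]; nlinarith
  rw [← hθ, hθ2]
  obtain ⟨c, hc⟩ : ∃ c, c = (Real.exp (θ / 2 / 2) - ε * Real.exp (-(θ / 2 / 2))) ^ 2 := ⟨_, rfl⟩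
  rw [← hc]
  have hmain := main_fubini θ c t (by linarith)
  have hJ := J_bound t θ ht (by linarith)
  set J := ∫ x in Set.Ioi (0:ℝ), Real.cos (t * x) * (((Real.exp (θ / 2) - Real.exp (-(θ / 2))) - max (Real.exp (θ / 2) - Real.exp (-(θ / 2)) * Real.exp x) 0) / Real.sinh x) with hJd
  have hintg : (∫ u : ℝ, (((1 / 2) / (1 / 4 + (t - u) ^ 2)) *
              ((Real.exp (θ / 2) + Real.exp (-(θ / 2))
                  - 2 * Real.cos (θ * (t - u))) / c)) *
            (deriv Complex.Gamma (1 / 4 + I * u / 2) /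
              Complex.Gamma (1 / 4 + I * u / 2)).re) = ∫ u : ℝ, HK θ c (t - u) * (digamma (1 / 4 + I * u / 2)).re := by
    rfl
  rw [hintg, hmain]
  set a := Real.exp (θ / 2) with ha
  set b := Real.exp (-(θ / 2)) with hb
  have hab : a * b = 1 := by rw [ha, hb, ← Real.exp_add]; simp
  have ha4 : 4 ≤ a := by
    have h1 : Real.exp (3/2) ≤ a := Real.exp_le_exp.2 (by linarith)
    have h2 : Real.exp (3/2) ^ 2 = Real.exp 1 ^ 3 := by
      rw [← Real.exp_nat_mul, ← Real.exp_nat_mul]; norm_num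
    have h3 := Real.exp_one_gt_d9
    have h4 : (2.7:ℝ)^3 ≤ Real.exp 1 ^ 3 := pow_le_pow_left₀ (by norm_num) (by linarith) 3
    have h5 : (4:ℝ)^2 ≤ Real.exp (3/2) ^ 2 := by rw [h2]; norm_num at h4 ⊢; linarith
    have h6 := abs_le_of_sq_le_sq h5 (Real.exp_pos _).le
    linarith [le_abs_self (4:ℝ)]
  have hc' : c = a + b - 2 * ε := by
    have e1 : Real.exp (θ/2/2) ^ 2 = a := by rw [ha, ← Real.exp_nat_mul]; congr 1; push_cast; ring
    have e2 : Real.exp (-(θ/2/2)) ^ 2 = b := by rw [hb, ← Real.exp_nat_mul]; congr 1; push_cast; ring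
    have e3 : Real.exp (θ/2/2) * Real.exp (-(θ/2/2)) = 1 := by rw [← Real.exp_add]; simp
    have e4 : ε^2 = 1 := by rcases hε with rfl | rfl <;> norm_num
    rw [hc]
    linear_combination e1 + ε^2 * e2 - 2 * ε * e3 + b * e4
  obtain ⟨hc0, hK, hK2, hc2⟩ := final_num a ε ha4 hε b c hab hc'
  have haa : Real.exp θ = a^2 := by rw [ha, ← Real.exp_nat_mul]; congr 1; push_cast; ring
  have hbb : Real.exp (-θ) = b^2 := by rw [hb, ← Real.exp_nat_mul]; congr 1; push_cast; ring
  have hn2 := final_num2 a b (Real.cosh θ) (Real.sinh θ) ha4 hab (by rw [Real.cosh_eq, haa, hbb]) (by rw [Real.sinh_eq, haa, hbb])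
  have hψ := digamma_log_bound (t/2) (by linarith)
  rw [show (1:ℂ)/2 + I * ((t/2 : ℝ) : ℂ) = 1/2 + I * t/2 by push_cast; ring,
    show 1 / (4 * (t/2)^2) = 1 / t^2 by field_simp; norm_num] at hψ
  set D := (digamma (1/2 + I * t/2)).re with hD
  refine ⟨(a - b)/(2*c) * (D - Real.log (t/2)) + 1/(2*c) * J, ?_, ?_⟩
  · have ht2 : 0 < t^2 := by positivity
    have hJ' : |J| ≤ 1.4 / t^2 := hJ.trans (div_le_div_of_nonneg_right hn2 ht2.le)
    refine (abs_add_le _ _).trans ?_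
    rw [abs_mul, abs_mul, abs_of_pos (show 0 < 1/(2*c) by positivity)]
    have m1 := mul_le_mul hK2 hψ (abs_nonneg _) (by norm_num)
    have m2 := mul_le_mul hc2 hJ' (abs_nonneg _) (by norm_num)
    refine (add_le_add m1 m2).trans ?_
    rw [show (5:ℝ)/6 * (1/t^2) + 2/9 * (1.4/t^2) = (5/6 + 2/9*1.4)/t^2 by ring]
    exact div_le_div_of_nonneg_right (by norm_num) ht2.le
  · rw [← hK]
    have := Real.pi_ne_zero
    field_simp
    ring
end
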